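/- Let μ_N = √(2N+1) and define φ_τ(s) = (2N)^{1/4} τ_N φ_N(μ_N + τ_N s) and ψ_τ(s) = (2N)^{1/4} τ_N φ_{N−1}(μ_N + τ_N s). For every real s_L there exist constants C > 0 and N₀ ∈ ℕ such that for all N ≥ N₀ and all s ≥ s_L: |φ_τ(s)| ≤ C e^{−s}, |ψ_τ(s)| ≤ C e^{−s}, |φ_τ(s) − Ai(s)| ≤ C N^{−2/3} e^{−s/2}, and |ψ_τ(s) − Ai(s) − Δ_N Ai'(s)| ≤ C N^{−2/3} e^{−s/2}. -/

import Mathlib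

open Real Filter MeasureTheory

/-- Physicists' Hermite polynomial `H_n(x) = (-1)^n e^{x²} (d^n/dx^n) e^{-x²}`. -/
noncomputable def physHermite (n : ℕ) (x : ℝ) : ℝ :=
  (-1 : ℝ) ^ n * Real.exp (x ^ 2) * iteratedDeriv n (fun t : ℝ => Real.exp (-t ^ 2)) x

/-- Normalizing constant `h_n = √π 2^n n!`. -/
noncomputable def hNorm (n : ℕ) : ℝ := Real.sqrt Real.pi * 2 ^ n * (n.factorial : ℝ)

/-- Oscillator wave function `φ_n(x) = h_n^{-1/2} e^{-x²/2} H_n(x)`. -/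
noncomputable def osc (n : ℕ) (x : ℝ) : ℝ :=
  hNorm n ^ (-(1 : ℝ) / 2) * Real.exp (-x ^ 2 / 2) * physHermite n x

/-- Airy function `Ai(x) = π⁻¹ lim_{R→∞} ∫₀^R cos(t³/3 + xt) dt`. -/
noncomputable def Ai (x : ℝ) : ℝ :=
  Real.pi⁻¹ *
    limUnder Filter.atTop (fun R : ℝ => ∫ t in (0 : ℝ)..R, Real.cos (t ^ 3 / 3 + x * t))

/-- Scaling constant `τ_N = 2^{-1/2} N^{-1/6}`. -/
noncomputable def tauN (N : ℕ) : ℝ := (2 : ℝ) ^ (-(1 : ℝ) / 2) * (N : ℝ) ^ (-(1 : ℝ) / 6)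

/-- `Δ_N = (√(2N+1) - √(2N-1))/τ_N`. -/
noncomputable def DeltaN (N : ℕ) : ℝ :=
  (Real.sqrt (2 * N + 1) - Real.sqrt (2 * N - 1)) / tauN N

/-- `φ_τ(s) = (2N)^{1/4} τ_N φ_N(√(2N+1) + τ_N s)`. -/
noncomputable def phiTauR (N : ℕ) (s : ℝ) : ℝ :=
  (2 * N : ℝ) ^ ((1 : ℝ) / 4) * tauN N * osc N (Real.sqrt (2 * N + 1) + tauN N * s)

/-- `ψ_τ(s) = (2N)^{1/4} τ_N φ_{N-1}(√(2N+1) + τ_N s)`. -/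
noncomputable def psiTauR (N : ℕ) (s : ℝ) : ℝ :=
  (2 * N : ℝ) ^ ((1 : ℝ) / 4) * tauN N * osc (N - 1) (Real.sqrt (2 * N + 1) + tauN N * s)

/-- The point `a + i t` of the vertical line with real part `a`. -/
noncomputable def vline (a t : ℝ) : ℂ := a + t * Complex.I

@[simp] lemma vline_re (a t : ℝ) : (vline a t).re = a := by simp [vline]

@[simp] lemma vline_im (a t : ℝ) : (vline a t).im = t := by simp [vline]

@[fun_prop] lemma continuous_vline (a : ℝ) : Continuous (vline a) := by
  unfold vline; fun_prop

lemma hasDerivAt_vline (a t : ℝ) : HasDerivAt (vline a) Complex.I t := by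
  have h := (Complex.ofRealCLM.hasDerivAt (x := t)).mul_const Complex.I
  convert! h.const_add (a : ℂ) using 1
  simp

lemma norm_vline_le (a t : ℝ) : ‖vline a t‖ ≤ |a| + |t| := by
  simpa using Complex.norm_le_abs_re_add_abs_im (vline a t)

lemma pow_mul_gaussian_le {A c : ℝ} (hA : 0 ≤ A) (hc : 0 < c) (n : ℕ) (t : ℝ) :
    (A + |t|) ^ n * rexp (-c * t ^ 2) ≤
      n.factorial * rexp (A + 1 / (2 * c)) * rexp (-(c / 2) * t ^ 2) := by
  have h1 := Real.pow_div_factorial_le_exp (A + |t|) (by positivity) n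
  rw [div_le_iff₀ (by positivity)] at h1
  have h2 : |t| ≤ 1 / (2 * c) + c / 2 * t ^ 2 := by
    have h3 : 0 ≤ (c * |t| - 1) ^ 2 / (2 * c) := by positivity
    have h4 : (c * |t| - 1) ^ 2 / (2 * c) = 1 / (2 * c) + c / 2 * t ^ 2 - |t| := by
      rw [← sq_abs t]; field_simp; ring
    linarith
  have h3 : rexp (A + |t|) * rexp (-c * t ^ 2) ≤
      rexp (A + 1 / (2 * c)) * rexp (-(c / 2) * t ^ 2) := by
    rw [← Real.exp_add, ← Real.exp_add]
    exact Real.exp_le_exp.mpr (by nlinarith)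
  calc (A + |t|) ^ n * rexp (-c * t ^ 2)
      ≤ rexp (A + |t|) * n.factorial * rexp (-c * t ^ 2) := by gcongr
    _ = n.factorial * (rexp (A + |t|) * rexp (-c * t ^ 2)) := by ring
    _ ≤ n.factorial * (rexp (A + 1 / (2 * c)) * rexp (-(c / 2) * t ^ 2)) := by gcongr
    _ = _ := by ring

lemma integrable_pow_mul_gaussian {A c : ℝ} (hA : 0 ≤ A) (hc : 0 < c) (n : ℕ) :
    Integrable fun t : ℝ => (A + |t|) ^ n * rexp (-c * t ^ 2) := by
  refine ((integrable_exp_neg_mul_sq (half_pos hc)).const_mul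
    (n.factorial * rexp (A + 1 / (2 * c)))).mono' (by fun_prop) ?_
  filter_upwards with t
  rw [Real.norm_of_nonneg (by positivity)]
  exact pow_mul_gaussian_le hA hc n t

section Laplace

variable {w : ℝ → ℂ} {K c : ℝ}

lemma norm_laplace_le (hK : ∀ t, ‖w t‖ ≤ K * rexp (-c * t ^ 2)) (a : ℝ) (n : ℕ) (x t : ℝ) :
    ‖(-vline a t) ^ n * w t * Complex.exp (-vline a t * x)‖ ≤
      K * rexp (-a * x) * ((|a| + |t|) ^ n * rexp (-c * t ^ 2)) := by
  have h1 : (-vline a t * x).re = -a * x := by simp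
  rw [norm_mul, norm_mul, norm_pow, norm_neg, Complex.norm_exp, h1]
  calc ‖vline a t‖ ^ n * ‖w t‖ * rexp (-a * x)
      ≤ (|a| + |t|) ^ n * (K * rexp (-c * t ^ 2)) * rexp (-a * x) := by
        gcongr
        · exact norm_vline_le a t
        · exact hK t
    _ = _ := by ring

lemma integrable_laplace (hw : Continuous w) (hc : 0 < c)
    (hK : ∀ t, ‖w t‖ ≤ K * rexp (-c * t ^ 2)) (a : ℝ) (n : ℕ) (x : ℝ) :
    Integrable fun t : ℝ => (-vline a t) ^ n * w t * Complex.exp (-vline a t * x) :=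
  ((integrable_pow_mul_gaussian (abs_nonneg a) hc n).const_mul (K * rexp (-a * x))).mono'
    (by fun_prop) (.of_forall fun t => norm_laplace_le hK a n x t)

lemma hasDerivAt_laplace (hw : Continuous w) (hc : 0 < c)
    (hK : ∀ t, ‖w t‖ ≤ K * rexp (-c * t ^ 2)) (a : ℝ) (n : ℕ) (x : ℝ) :
    HasDerivAt (fun y : ℝ => ∫ t, (-vline a t) ^ n * w t * Complex.exp (-vline a t * y))
      (∫ t, (-vline a t) ^ (n + 1) * w t * Complex.exp (-vline a t * x)) x := by
  have hK0 : 0 ≤ K := by simpa using (norm_nonneg _).trans (hK 0)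
  refine (hasDerivAt_integral_of_dominated_loc_of_deriv_le (Metric.ball_mem_nhds x one_pos)
    (.of_forall fun y => (integrable_laplace hw hc hK a n y).aestronglyMeasurable)
    (integrable_laplace hw hc hK a n x)
    (integrable_laplace hw hc hK a (n + 1) x).aestronglyMeasurable
    (F' := fun y t => (-vline a t) ^ (n + 1) * w t * Complex.exp (-vline a t * y))
    (bound := fun t => K * rexp (|a| * (|x| + 1)) * ((|a| + |t|) ^ (n + 1) * rexp (-c * t ^ 2)))
    (.of_forall fun t y hy => ?_)
    ((integrable_pow_mul_gaussian (abs_nonneg a) hc (n + 1)).const_mul _)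
    (.of_forall fun t y _ => ?_)).2
  · refine (norm_laplace_le hK a (n + 1) y t).trans ?_
    have hy' : |y| ≤ |x| + 1 := by
      rw [Metric.mem_ball, Real.dist_eq] at hy
      linarith [abs_sub_abs_le_abs_sub y x]
    have h2 : -a * y ≤ |a| * (|x| + 1) := by
      calc -a * y ≤ |-a * y| := le_abs_self _
        _ = |a| * |y| := by rw [abs_mul, abs_neg]
        _ ≤ _ := by gcongr
    gcongr
  · have h1 : HasDerivAt (fun y : ℝ => -vline a t * (y : ℂ)) (-vline a t) y := by
      simpa using (Complex.ofRealCLM.hasDerivAt (x := y)).const_mul (-vline a t)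
    convert! (h1.cexp).const_mul ((-vline a t) ^ n * w t) using 1
    ring

end Laplace

lemma norm_exp_vline_sq_div_four (a t : ℝ) :
    ‖Complex.exp (vline a t ^ 2 / 4)‖ ≤ rexp (a ^ 2 / 4) * rexp (-(1 / 4) * t ^ 2) := by
  have h1 : (vline a t ^ 2 / 4).re = a ^ 2 / 4 + -(1 / 4) * t ^ 2 := by
    have : (vline a t ^ 2 / 4) = ((a ^ 2 / 4 - t ^ 2 / 4 : ℝ) : ℂ)
        + ((a * t / 2 : ℝ) : ℂ) * Complex.I := by
      push_cast; rw [vline]; ring_nf; rw [Complex.I_sq]; ring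
    rw [this, Complex.add_re, Complex.ofReal_re, Complex.re_ofReal_mul, Complex.I_re]; ring
  rw [Complex.norm_exp, h1, Real.exp_add]

lemma iteratedDeriv_gaussian_eq_integral (n : ℕ) (a x : ℝ) :
    ((iteratedDeriv n (fun t : ℝ => rexp (-t ^ 2)) x : ℝ) : ℂ) =
      (2 * √π : ℝ)⁻¹ * ∫ t, (-vline a t) ^ n * Complex.exp (vline a t ^ 2 / 4) *
        Complex.exp (-vline a t * x) := by
  induction n generalizing x with
  | zero =>
    have h1 : ∀ t : ℝ, (-vline a t) ^ 0 * Complex.exp (vline a t ^ 2 / 4) *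
        Complex.exp (-vline a t * x) = Complex.exp (-(1 / 4 : ℂ) *
          (t + ((2 * x - a : ℝ) : ℂ) * Complex.I) ^ 2) * Complex.exp (-x ^ 2) := by
      intro t
      rw [pow_zero, one_mul, ← Complex.exp_add, ← Complex.exp_add]
      congr 1
      rw [vline]; push_cast; ring_nf; rw [Complex.I_sq]; ring
    simp_rw [h1]
    rw [integral_mul_const, GaussianFourier.integral_cexp_neg_mul_sq_add_real_mul_I (by norm_num)]
    have h2 : ((π : ℂ) / (1 / 4)) ^ (1 / 2 : ℂ) = ((2 * √π : ℝ) : ℂ) := by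
      have : ((π : ℂ) / (1 / 4)) = ((2 ^ 2 * π : ℝ) : ℂ) := by push_cast; ring
      rw [this, show (1 / 2 : ℂ) = ((1 / 2 : ℝ) : ℂ) by push_cast; rfl,
        ← Complex.ofReal_cpow (by positivity), ← Real.sqrt_eq_rpow, Real.sqrt_mul (by norm_num),
        Real.sqrt_sq (by norm_num)]
    rw [h2, ← mul_assoc]
    have h3 : (2 * √π : ℝ) ≠ 0 := by positivity
    rw [← Complex.ofReal_mul, inv_mul_cancel₀ h3]
    simp
  | succ n ih =>
    have h1 := (hasDerivAt_laplace (w := fun t => Complex.exp (vline a t ^ 2 / 4)) (by fun_prop)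
      (by norm_num : (0 : ℝ) < 1 / 4) (norm_exp_vline_sq_div_four a) a n x).const_mul
        (((2 * √π : ℝ)⁻¹ : ℝ) : ℂ)
    have h2 : HasDerivAt (fun y : ℝ =>
        ((iteratedDeriv n (fun t : ℝ => rexp (-t ^ 2)) y : ℝ) : ℂ)) _ x :=
      h1.congr_of_eventuallyEq (.of_forall fun y => ih y)
    have h3 := Complex.reCLM.hasFDerivAt.comp_hasDerivAt x h2
    have h4 : HasDerivAt (iteratedDeriv n (fun t : ℝ => rexp (-t ^ 2))) _ x := h3
    rw [iteratedDeriv_succ, h4.deriv]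
    exact h4.ofReal_comp.unique h2

lemma re_vline_cube (a t : ℝ) : (vline a t ^ 3 / 3).re = a ^ 3 / 3 - a * t ^ 2 := by
  have : vline a t ^ 3 / 3 = ((a ^ 3 / 3 - a * t ^ 2 : ℝ) : ℂ) +
      ((a ^ 2 * t - t ^ 3 / 3 : ℝ) : ℂ) * Complex.I := by
    have h : Complex.I ^ 3 = -Complex.I := by rw [pow_succ, Complex.I_sq]; ring
    push_cast; rw [vline]; ring_nf; rw [Complex.I_sq, h]; ring
  rw [this, Complex.add_re, Complex.ofReal_re, Complex.re_ofReal_mul, Complex.I_re]; ring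

lemma norm_exp_vline_cube_div_three (a t : ℝ) :
    ‖Complex.exp (vline a t ^ 3 / 3)‖ = rexp (a ^ 3 / 3) * rexp (-a * t ^ 2) := by
  rw [Complex.norm_exp, re_vline_cube, ← Real.exp_add]; ring_nf

/-- The integrand of the Airy integral, extended to the complex plane. -/
noncomputable def airyKernel (x : ℝ) (z : ℂ) : ℂ := Complex.exp (z ^ 3 / 3) * Complex.exp (-z * x)

@[fun_prop] lemma continuous_airyKernel (x : ℝ) : Continuous (airyKernel x) := by
  unfold airyKernel; fun_prop

lemma norm_airyKernel_vline (x a t : ℝ) :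
    ‖airyKernel x (vline a t)‖ = rexp (a ^ 3 / 3 - a * x) * rexp (-a * t ^ 2) := by
  have h : (-vline a t * x).re = -a * x := by simp
  rw [airyKernel, norm_mul, norm_exp_vline_cube_div_three, Complex.norm_exp, h, ← Real.exp_add,
    ← Real.exp_add, ← Real.exp_add]
  ring_nf

lemma integrable_pow_mul_airyKernel {b : ℝ} (hb : 0 < b) (n : ℕ) (x : ℝ) :
    Integrable fun t : ℝ => vline b t ^ n * airyKernel x (vline b t) := by
  refine ((integrable_laplace (w := fun t => Complex.exp (vline b t ^ 3 / 3)) (by fun_prop) hb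
    (fun t => (norm_exp_vline_cube_div_three b t).le) b n x).const_mul ((-1) ^ n)).congr
      (.of_forall fun t => ?_)
  simp only [airyKernel]
  rw [neg_pow (vline b t) n, ← mul_assoc, ← mul_assoc, ← mul_assoc, ← mul_pow]
  norm_num [mul_assoc]

lemma intervalIntegral_airyKernel_imaginary (x R : ℝ) :
    ∫ y in (-R)..R, airyKernel x (vline 0 y) =
      2 * ((∫ t in (0 : ℝ)..R, Real.cos (t ^ 3 / 3 + x * t) : ℝ) : ℂ) := by
  have hc : Continuous fun y : ℝ => airyKernel x (vline 0 y) := by fun_prop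
  have h1 : ∫ y in (-R)..0, airyKernel x (vline 0 y) =
      ∫ y in (0 : ℝ)..R, airyKernel x (vline 0 (-y)) := by
    simpa using (intervalIntegral.integral_comp_neg (a := 0) (b := R)
      (fun y => airyKernel x (vline 0 y))).symm
  have hc' : Continuous fun y : ℝ => airyKernel x (vline 0 (-y)) := by fun_prop
  rw [← intervalIntegral.integral_add_adjacent_intervals (hc.intervalIntegrable (-R) 0)
    (hc.intervalIntegrable 0 R), h1, ← intervalIntegral.integral_add (hc'.intervalIntegrable _ _)
    (hc.intervalIntegrable _ _), ← intervalIntegral.integral_ofReal,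
    ← intervalIntegral.integral_const_mul]
  congr 1
  ext y
  have h : Complex.I ^ 3 = -Complex.I := by rw [pow_succ, Complex.I_sq]; ring
  rw [Complex.ofReal_cos, Complex.two_cos]
  simp only [airyKernel, vline, ← Complex.exp_add]
  congr 2 <;> push_cast <;> ring_nf <;> rw [h] <;> ring

lemma tendsto_airyKernel_horizontal {b : ℝ} (hb : 0 < b) (x : ℝ) {g : ℝ → ℝ}
    (hg : Tendsto (fun R => g R ^ 2) atTop atTop) :
    Tendsto (fun R : ℝ => ∫ σ in (0 : ℝ)..b, airyKernel x (vline σ (g R))) atTop (nhds 0) := by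
  have h0 : ∫ _ in (0 : ℝ)..b, (0 : ℂ) = 0 := by simp
  rw [← h0]
  refine intervalIntegral.tendsto_integral_filter_of_dominated_convergence
    (fun _ => rexp (b ^ 3 / 3 + b * |x|)) (.of_forall fun R => ?_)
    (.of_forall fun R => .of_forall fun σ hσ => ?_) (by simp) (.of_forall fun σ hσ => ?_)
  · unfold vline
    exact Continuous.aestronglyMeasurable (by fun_prop)
  · rw [Set.uIoc_of_le hb.le] at hσ
    rw [norm_airyKernel_vline, ← Real.exp_add]
    refine Real.exp_le_exp.mpr ?_
    have h1 : σ ^ 3 ≤ b ^ 3 := pow_le_pow_left₀ hσ.1.le hσ.2 3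
    have h2 : -(σ * x) ≤ b * |x| := by
      calc -(σ * x) = σ * (-x) := by ring
        _ ≤ σ * |x| := mul_le_mul_of_nonneg_left (neg_le_abs x) hσ.1.le
        _ ≤ b * |x| := mul_le_mul_of_nonneg_right hσ.2 (abs_nonneg x)
    have h3 : 0 ≤ σ * g R ^ 2 := mul_nonneg hσ.1.le (sq_nonneg _)
    linarith
  · rw [Set.uIoc_of_le hb.le] at hσ
    rw [tendsto_zero_iff_norm_tendsto_zero]
    simp_rw [norm_airyKernel_vline]
    rw [← mul_zero (rexp (σ ^ 3 / 3 - σ * x))]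
    refine Tendsto.const_mul _ (Real.tendsto_exp_atBot.comp ?_)
    exact hg.const_mul_atTop_of_neg (by linarith [hσ.1])

/-- The Airy function as an absolutely convergent integral along the line `Re z = b`. -/
lemma Ai_eq_integral {b : ℝ} (hb : 0 < b) (x : ℝ) :
    (Ai x : ℂ) = (2 * π : ℂ)⁻¹ * ∫ t, airyKernel x (vline b t) := by
  set J : ℂ := ∫ t, airyKernel x (vline b t) with hJ
  have hInt : Integrable fun t : ℝ => airyKernel x (vline b t) := by
    simpa using integrable_pow_mul_airyKernel hb 0 x
  have h1 : Tendsto (fun R : ℝ => ∫ y in (-R)..R, airyKernel x (vline b y)) atTop (nhds J) :=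
    intervalIntegral_tendsto_integral hInt tendsto_neg_atTop_atBot tendsto_id
  have h2 : Tendsto (fun R : ℝ => ∫ σ in (0 : ℝ)..b, airyKernel x (vline σ R)) atTop (nhds 0) :=
    tendsto_airyKernel_horizontal hb x (tendsto_pow_atTop two_ne_zero)
  have h3 : Tendsto (fun R : ℝ => ∫ σ in (0 : ℝ)..b, airyKernel x (vline σ (-R)))
      atTop (nhds 0) :=
    tendsto_airyKernel_horizontal hb x (by simp)
  have hrect : ∀ R : ℝ, 2 * ((∫ t in (0 : ℝ)..R, Real.cos (t ^ 3 / 3 + x * t) : ℝ) : ℂ) =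
      (∫ y in (-R)..R, airyKernel x (vline b y)) -
        Complex.I * ((∫ σ in (0 : ℝ)..b, airyKernel x (vline σ (-R))) -
          ∫ σ in (0 : ℝ)..b, airyKernel x (vline σ R)) := by
    intro R
    have hd : Differentiable ℂ (airyKernel x) := by unfold airyKernel; fun_prop
    have h := Complex.integral_boundary_rect_eq_zero_of_differentiableOn (airyKernel x)
      (vline 0 (-R)) (vline b R) hd.differentiableOn
    simp only [vline_re, vline_im, smul_eq_mul] at h
    rw [← intervalIntegral_airyKernel_imaginary]
    unfold vline
    linear_combination Complex.I * h - ((∫ y in (-R)..R, airyKernel x (b + y * Complex.I)) -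
      ∫ y in (-R)..R, airyKernel x ((0 : ℝ) + y * Complex.I)) * Complex.I_sq
  have h4 : Tendsto (fun R : ℝ =>
      2 * ((∫ t in (0 : ℝ)..R, Real.cos (t ^ 3 / 3 + x * t) : ℝ) : ℂ)) atTop (nhds J) := by
    simp_rw [hrect]
    simpa using h1.sub ((h3.sub h2).const_mul Complex.I)
  have h5 : Tendsto (fun R : ℝ => ∫ t in (0 : ℝ)..R, Real.cos (t ^ 3 / 3 + x * t))
      atTop (nhds ((J / 2).re)) := by
    refine (Complex.continuous_re.tendsto _).comp (h4.div_const 2) |>.congr fun R => ?_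
    simp
  have h6 : ((J / 2).re : ℂ) = J / 2 := by
    refine tendsto_nhds_unique ((Complex.continuous_ofReal.tendsto _).comp h5)
      ((h4.div_const 2).congr fun R => ?_)
    simp
  rw [Ai, h5.limUnder_eq, Complex.ofReal_mul, h6]
  push_cast
  field_simp

lemma hasDerivAt_Ai {b : ℝ} (hb : 0 < b) (x : ℝ) :
    HasDerivAt Ai (deriv Ai x) x ∧
      ((deriv Ai x : ℝ) : ℂ) = (2 * π : ℂ)⁻¹ * ∫ t, -vline b t * airyKernel x (vline b t) := by
  have h1 := (hasDerivAt_laplace (w := fun t => Complex.exp (vline b t ^ 3 / 3)) (by fun_prop)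
    hb (fun t => (norm_exp_vline_cube_div_three b t).le) b 0 x).const_mul ((2 * π : ℂ)⁻¹)
  simp only [pow_zero, one_mul, zero_add, pow_one] at h1
  have h2 : HasDerivAt (fun y : ℝ => (Ai y : ℂ)) _ x :=
    h1.congr_of_eventuallyEq (.of_forall fun y => Ai_eq_integral hb y)
  have h3 : HasDerivAt Ai _ x := Complex.reCLM.hasFDerivAt.comp_hasDerivAt x h2
  refine ⟨h3.differentiableAt.hasDerivAt, ?_⟩
  rw [h3.deriv, h3.ofReal_comp.unique h2]
  simp only [airyKernel, mul_assoc]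

/-- Integral of the total derivative of `(z ^ 2 + x) e ^ {z ^ 3 / 3 - x z}`. -/
lemma integral_airyKernel_quartic {b : ℝ} (hb : 0 < b) (x : ℝ) :
    ∫ t, (2 * vline b t + vline b t ^ 4 - x ^ 2) * airyKernel x (vline b t) = 0 := by
  have hd : ∀ t : ℝ, HasDerivAt (fun t => (vline b t ^ 2 + x) * airyKernel x (vline b t))
      (Complex.I * ((2 * vline b t + vline b t ^ 4 - x ^ 2) * airyKernel x (vline b t))) t := by
    intro t
    have h1 := hasDerivAt_vline b t
    have h2 := (((h1.pow 3).div_const 3).cexp).mul (((h1.neg).mul_const (x : ℂ)).cexp)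
    have h3 := ((h1.pow 2).add_const (x : ℂ)).mul h2
    convert! h3 using 1
    simp only [airyKernel]
    push_cast
    simp
    ring
  have h0 := integrable_pow_mul_airyKernel hb 0 x
  have h1 := integrable_pow_mul_airyKernel hb 1 x
  have h2 := integrable_pow_mul_airyKernel hb 2 x
  have h4 := integrable_pow_mul_airyKernel hb 4 x
  have h := integral_eq_zero_of_hasDerivAt_of_integrable hd ?_ ?_
  · rw [integral_const_mul] at h
    simpa using h
  · refine ((((h1.const_mul 2).add h4).sub (h0.const_mul ((x : ℂ) ^ 2))).const_mul
      Complex.I).congr (.of_forall fun t => ?_)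
    simp; ring
  · refine (h2.add (h0.const_mul (x : ℂ))).congr (.of_forall fun t => ?_)
    simp; ring

lemma norm_log_one_add_sub_logTaylor_le (n : ℕ) {z : ℂ} (hz : 0 ≤ z.re) :
    ‖Complex.log (1 + z) - Complex.logTaylor (n + 1) z‖ ≤ ‖z‖ ^ (n + 1) := by
  set S : Set ℂ := {w | 0 ≤ w.re} ∩ Metric.closedBall 0 ‖z‖ with hS
  have hconv : Convex ℝ S := (convex_halfSpace_re_ge 0).inter (convex_closedBall _ _)
  have hder : ∀ w ∈ S, HasDerivWithinAt
      (fun w : ℂ => Complex.log (1 + w) - Complex.logTaylor (n + 1) w)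
      ((-w) ^ n * (1 + w)⁻¹) S w := by
    intro w hw
    have hw0 : 0 ≤ w.re := hw.1
    refine (Complex.hasDerivAt_log_sub_logTaylor n ?_).hasDerivWithinAt
    exact Or.inl (by simp; linarith)
  have hbd : ∀ w ∈ S, ‖(-w) ^ n * (1 + w)⁻¹‖ ≤ ‖z‖ ^ n := by
    intro w hw
    have hw0 : 0 ≤ w.re := hw.1
    have hw1 : ‖w‖ ≤ ‖z‖ := by simpa using hw.2
    have h1 : 1 ≤ ‖1 + w‖ := by
      refine le_trans ?_ (Complex.re_le_norm _)
      simp; linarith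
    rw [norm_mul, norm_pow, norm_neg, norm_inv]
    calc ‖w‖ ^ n * ‖1 + w‖⁻¹ ≤ ‖z‖ ^ n * 1 := by
          gcongr
          exact inv_le_one_of_one_le₀ h1
      _ = ‖z‖ ^ n := mul_one _
  have h := hconv.norm_image_sub_le_of_norm_hasDerivWithin_le hder hbd
    (show (0 : ℂ) ∈ S by simp [hS]) (show z ∈ S by simp [hS, hz])
  simpa [Complex.logTaylor_at_zero, pow_succ] using h

lemma norm_exp_sub_one_sub_le (z : ℂ) :
    ‖Complex.exp z - 1 - z‖ ≤ ‖z‖ ^ 2 * max 1 ‖Complex.exp z‖ := by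
  set S : Set ℂ := {w | w.re ≤ max 0 z.re} ∩ Metric.closedBall 0 ‖z‖ with hS
  have hconv : Convex ℝ S := (convex_halfSpace_re_le _).inter (convex_closedBall _ _)
  set K : ℝ := max 1 ‖Complex.exp z‖ with hK
  have hzero : (0 : ℂ) ∈ S := by simp [hS]
  have hexp : ∀ w ∈ S, ‖Complex.exp w‖ ≤ K := by
    intro w hw
    have hw0 : w.re ≤ max 0 z.re := hw.1
    rw [hK, Complex.norm_exp, Complex.norm_exp, ← Real.exp_zero, ← Real.exp_monotone.map_max]
    exact Real.exp_le_exp.mpr hw0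
  have hK0 : 0 ≤ K := le_trans zero_le_one (le_max_left _ _)
  have h1 : ∀ w ∈ S, ‖Complex.exp w - 1‖ ≤ K * ‖z‖ := by
    intro w hw
    have hw1 : ‖w‖ ≤ ‖z‖ := by simpa using hw.2
    have h := hconv.norm_image_sub_le_of_norm_hasDerivWithin_le
      (fun w _ => (Complex.hasDerivAt_exp w).hasDerivWithinAt) hexp hzero hw
    simp only [Complex.exp_zero, sub_zero] at h
    exact h.trans (by gcongr)
  have h2 := hconv.norm_image_sub_le_of_norm_hasDerivWithin_le
    (f := fun w => Complex.exp w - w)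
    (fun w _ => ((Complex.hasDerivAt_exp w).sub (hasDerivAt_id w)).hasDerivWithinAt) h1 hzero
    (show z ∈ S by simp [hS])
  simp only [Complex.exp_zero, sub_zero] at h2
  calc ‖Complex.exp z - 1 - z‖ = ‖Complex.exp z - z - 1‖ := by ring_nf
    _ ≤ K * ‖z‖ * ‖z‖ := h2
    _ = _ := by ring

/-- The contour integrand of the Hermite function, rescaled around its turning point: `ε` is the
square of the length scale and `κ` the ratio between the actual and the ideal cubic scale. -/
noncomputable def hermiteKernel (m : ℕ) (ε κ s : ℝ) (z : ℂ) : ℂ :=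
  (1 + 2 * κ * ε * z) ^ m *
    Complex.exp (ε * s ^ 2 / 2 - s * z + z ^ 2 / (4 * ε) - z / (4 * κ * ε ^ 2))

@[fun_prop] lemma continuous_hermiteKernel (m : ℕ) (ε κ s : ℝ) :
    Continuous (hermiteKernel m ε κ s) := by
  unfold hermiteKernel; fun_prop

lemma norm_hermiteKernel_le {m : ℕ} {ε κ s b L : ℝ} (hε : 0 < ε) (hε' : ε ≤ 1 / 4)
    (hκ : 1 / 2 ≤ κ) (hm : m ≤ 1 / (8 * κ ^ 2 * ε ^ 3)) (hb : 4 ≤ b) (hL : 0 ≤ L)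
    (hL' : 1 + 2 * κ * ε * b ≤ rexp L) (t : ℝ) :
    ‖hermiteKernel m ε κ s (vline b t)‖ ≤
      rexp (L / (8 * κ ^ 2 * ε ^ 3) + ε * s ^ 2 / 2 - s * b + b ^ 2 / (4 * ε) -
        b / (4 * κ * ε ^ 2)) * rexp (-(1 / 2) * t ^ 2) := by
  have hκ0 : 0 < κ := by linarith
  set y : ℝ := 2 * κ * ε * b with hy
  have hy4 : 4 * ε ≤ y := by rw [hy]; nlinarith [mul_pos hε hκ0]
  have hy0 : 0 < y := by linarith
  set v : ℝ := (2 * κ * ε * t) ^ 2 / (1 + y) ^ 2 with hv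
  have hv0 : 0 ≤ v := by positivity
  have h1 : ‖1 + 2 * κ * ε * vline b t‖ ≤ rexp (L + v / 2) := by
    refine (pow_le_pow_iff_left₀ (norm_nonneg _) (Real.exp_pos _).le two_ne_zero).mp ?_
    rw [← Complex.normSq_eq_norm_sq, ← Real.exp_nat_mul]
    have e1 : (1 + 2 * κ * ε * vline b t : ℂ) = vline (1 + y) (2 * κ * ε * t) := by
      simp only [vline, hy]; push_cast; ring
    rw [e1, Complex.normSq_apply, vline_re, vline_im]
    calc (1 + y) * (1 + y) + 2 * κ * ε * t * (2 * κ * ε * t) = (1 + y) ^ 2 * (v + 1) := by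
          rw [hv]; field_simp; ring
      _ ≤ rexp L ^ 2 * rexp v := by gcongr; exact Real.add_one_le_exp v
      _ = _ := by rw [← Real.exp_nat_mul, ← Real.exp_add]; push_cast; ring_nf
  have h2 : (ε * s ^ 2 / 2 - s * vline b t + vline b t ^ 2 / (4 * ε) -
      vline b t / (4 * κ * ε ^ 2) : ℂ).re = ε * s ^ 2 / 2 - s * b + b ^ 2 / (4 * ε) -
        b / (4 * κ * ε ^ 2) - t ^ 2 / (4 * ε) := by
    have : (ε * s ^ 2 / 2 - s * vline b t + vline b t ^ 2 / (4 * ε) -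
      vline b t / (4 * κ * ε ^ 2) : ℂ) = ((ε * s ^ 2 / 2 - s * b + b ^ 2 / (4 * ε) -
        b / (4 * κ * ε ^ 2) - t ^ 2 / (4 * ε) : ℝ) : ℂ) +
        ((- s * t + 2 * b * t / (4 * ε) - t / (4 * κ * ε ^ 2) : ℝ) : ℂ) * Complex.I := by
      push_cast; rw [vline]; ring_nf; rw [Complex.I_sq]; ring
    rw [this, Complex.add_re, Complex.ofReal_re, Complex.re_ofReal_mul, Complex.I_re]; ring
  rw [hermiteKernel, norm_mul, norm_pow, Complex.norm_exp, h2]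
  calc ‖1 + 2 * κ * ε * vline b t‖ ^ m * rexp (ε * s ^ 2 / 2 - s * b + b ^ 2 / (4 * ε) -
        b / (4 * κ * ε ^ 2) - t ^ 2 / (4 * ε))
      ≤ rexp (L + v / 2) ^ m * rexp (ε * s ^ 2 / 2 - s * b + b ^ 2 / (4 * ε) -
        b / (4 * κ * ε ^ 2) - t ^ 2 / (4 * ε)) := by gcongr
    _ ≤ _ := by
      rw [← Real.exp_nat_mul, ← Real.exp_add, ← Real.exp_add]
      refine Real.exp_le_exp.mpr ?_
      have h3 : m * (L + v / 2) ≤ 1 / (8 * κ ^ 2 * ε ^ 3) * (L + v / 2) := by gcongr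
      have h4 : 1 / (8 * κ ^ 2 * ε ^ 3) * (L + v / 2) =
          L / (8 * κ ^ 2 * ε ^ 3) + t ^ 2 / (4 * ε * (1 + y) ^ 2) := by
        rw [hv]; field_simp; ring
      have h5 : t ^ 2 / (4 * ε * (1 + y) ^ 2) ≤ t ^ 2 / (4 * ε) - 1 / 2 * t ^ 2 := by
        have e : t ^ 2 / (4 * ε) - 1 / 2 * t ^ 2 - t ^ 2 / (4 * ε * (1 + y) ^ 2) =
            t ^ 2 * ((1 - 2 * ε) * (1 + y) ^ 2 - 1) / (4 * ε * (1 + y) ^ 2) := by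
          field_simp; ring
        have : 0 ≤ (1 - 2 * ε) * (1 + y) ^ 2 - 1 := by
          have : (1 + 4 * ε) ^ 2 ≤ (1 + y) ^ 2 := by gcongr
          nlinarith
        have : 0 ≤ t ^ 2 * ((1 - 2 * ε) * (1 + y) ^ 2 - 1) / (4 * ε * (1 + y) ^ 2) := by
          positivity
        linarith
      linarith

lemma norm_hermiteKernel_le_near {m : ℕ} {ε κ s : ℝ} (hε : 0 < ε) (hε' : ε ≤ 1 / 4)
    (hκ : 1 / 2 ≤ κ) (hκ' : κ ≤ 1) (hm : m ≤ 1 / (8 * κ ^ 2 * ε ^ 3)) (t : ℝ) :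
    ‖hermiteKernel m ε κ s (vline 4 t)‖ ≤
      rexp (64 + ε * s ^ 2 / 2 - 4 * s) * rexp (-(1 / 2) * t ^ 2) := by
  have hκ0 : 0 < κ := by linarith
  set y : ℝ := 2 * κ * ε * 4 with hy
  have hy0 : 0 ≤ y := by positivity
  have h1 : 1 + y ≤ rexp (y - y ^ 2 / 2 + y ^ 3) := by
    rw [← Real.log_le_iff_le_exp (by positivity)]
    have h := norm_log_one_add_sub_logTaylor_le 2 (z := (y : ℂ)) (by simpa using hy0)
    have e : Complex.log (1 + y) - Complex.logTaylor (2 + 1) y =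
        ((Real.log (1 + y) - (y - y ^ 2 / 2) : ℝ) : ℂ) := by
      push_cast
      rw [Complex.ofReal_log (by positivity)]
      simp [Complex.logTaylor_succ, Complex.logTaylor_zero]
      ring
    rw [e, Complex.norm_real, Complex.norm_real, Real.norm_eq_abs, Real.norm_eq_abs,
      abs_of_nonneg hy0] at h
    linarith [le_abs_self (Real.log (1 + y) - (y - y ^ 2 / 2))]
  refine (norm_hermiteKernel_le hε hε' hκ hm le_rfl ?_ h1 t).trans ?_
  · nlinarith [sq_nonneg (y - 1), mul_nonneg hy0 (sq_nonneg (y - 1))]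
  · refine mul_le_mul_of_nonneg_right (Real.exp_le_exp.mpr ?_) (Real.exp_pos _).le
    have : (y - y ^ 2 / 2 + y ^ 3) / (8 * κ ^ 2 * ε ^ 3) =
        64 * κ - 4 ^ 2 / (4 * ε) + 4 / (4 * κ * ε ^ 2) := by
      rw [hy]; field_simp; ring
    linarith

lemma norm_hermiteKernel_le_far {m : ℕ} {ε κ s : ℝ} (hε : 0 < ε) (hε' : ε ≤ 1 / 4)
    (hκ : 1 / 2 ≤ κ) (hm : m ≤ 1 / (8 * κ ^ 2 * ε ^ 3)) (hs : 4 ≤ ε * s) (t : ℝ) :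
    ‖hermiteKernel m ε κ s (vline (ε * s) t)‖ ≤
      rexp (-(ε * s ^ 2 / 4)) * rexp (-(1 / 2) * t ^ 2) := by
  have hκ0 : 0 < κ := by linarith
  refine (norm_hermiteKernel_le hε hε' hκ hm hs (L := 2 * κ * ε * (ε * s)) (by positivity) ?_
    t).trans ?_
  · linarith [Real.add_one_le_exp (2 * κ * ε * (ε * s))]
  · gcongr
    refine le_of_eq ?_
    field_simp; ring

/-- First-order correction of `hermiteKernel` relative to `airyKernel`. -/
noncomputable def kernelCorrection (p ε s : ℝ) (z : ℂ) : ℂ :=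
  ε * (s ^ 2 / 2 - z ^ 4 / 2 - 2 * p * z)

lemma norm_kernelCorrection_le {p ε s : ℝ} (hε : 0 < ε) (hp : 0 ≤ p) (hp' : p ≤ 2)
    {z : ℂ} (hz : 1 ≤ ‖z‖) :
    ‖kernelCorrection p ε s z‖ ≤ 5 * ε * ((1 + s ^ 2) * ‖z‖ ^ 5) := by
  have h1 : ‖z‖ ≤ ‖z‖ ^ 5 := le_self_pow₀ hz (by norm_num)
  have h4 : ‖z‖ ^ 4 ≤ ‖z‖ ^ 5 := pow_le_pow_right₀ hz (by norm_num)
  have h0 : 1 ≤ ‖z‖ ^ 5 := one_le_pow₀ hz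
  have e : ‖kernelCorrection p ε s z‖ ≤ ε * (s ^ 2 / 2 + ‖z‖ ^ 4 / 2 + 2 * p * ‖z‖) := by
    rw [kernelCorrection, norm_mul, Complex.norm_real, Real.norm_of_nonneg hε.le]
    gcongr
    refine (norm_sub_le _ _).trans (add_le_add ((norm_sub_le _ _).trans (add_le_add ?_ ?_)) ?_)
    · simp
    · simp
    · simp [abs_of_nonneg hp]
  refine e.trans ?_
  have h2 : s ^ 2 / 2 + ‖z‖ ^ 4 / 2 + 2 * p * ‖z‖ ≤ 5 * ((1 + s ^ 2) * ‖z‖ ^ 5) := by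
    have : p * ‖z‖ ≤ 2 * ‖z‖ := by gcongr
    nlinarith [sq_nonneg s, mul_nonneg (sq_nonneg s) (sub_nonneg.mpr h0)]
  nlinarith

lemma exists_hermiteKernel_eq {m : ℕ} {p ε κ s : ℝ} (hε : 0 < ε) (hε' : ε ≤ 1 / 4)
    (hκ : 1 / 2 ≤ κ) (hκ' : κ ≤ 1) (hκε : 1 - κ ≤ 2 * ε ^ 3) (hp : 0 ≤ p) (hp' : p ≤ 2)
    (hm : m + p = 1 / (8 * κ ^ 2 * ε ^ 3)) {z : ℂ} (hz : 0 ≤ z.re) (hz1 : 1 ≤ ‖z‖) :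
    ∃ δ : ℂ, hermiteKernel m ε κ s z = airyKernel s z * Complex.exp δ ∧
      ‖δ - kernelCorrection p ε s z‖ ≤ 24 * ε ^ 2 * ‖z‖ ^ 5 := by
  have hκ0 : 0 < κ := by linarith
  set y : ℂ := 2 * κ * ε * z with hy
  have hyre : y = ((2 * κ * ε : ℝ) : ℂ) * z := by rw [hy]; push_cast; ring
  have hy0 : 0 ≤ y.re := by rw [hyre, Complex.re_ofReal_mul]; positivity
  have hyn : ‖y‖ = 2 * κ * ε * ‖z‖ := by
    rw [hyre, norm_mul, Complex.norm_real, Real.norm_of_nonneg (by positivity)]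
  have hne : 1 + y ≠ 0 := by
    intro h
    have := congrArg Complex.re h
    simp at this
    linarith
  have hr2 := norm_log_one_add_sub_logTaylor_le 1 hy0
  have hr5 := norm_log_one_add_sub_logTaylor_le 4 hy0
  simp only [Complex.logTaylor_succ, Complex.logTaylor_zero, Pi.add_apply] at hr2 hr5
  set r2 : ℂ := Complex.log (1 + y) - y with hr2'
  set r5 : ℂ := Complex.log (1 + y) - (y - y ^ 2 / 2 + y ^ 3 / 3 - y ^ 4 / 4) with hr5'
  have hr2 : ‖r2‖ ≤ ‖y‖ ^ 2 := by
    refine le_trans (le_of_eq ?_) hr2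
    congr 1; rw [hr2']; norm_num
  have hr5 : ‖r5‖ ≤ ‖y‖ ^ 5 := by
    refine le_trans (le_of_eq ?_) hr5
    congr 1; rw [hr5']; norm_num; ring
  have hκc : (κ : ℂ) ≠ 0 := by exact_mod_cast hκ0.ne'
  have hεc : (ε : ℂ) ≠ 0 := by exact_mod_cast hε.ne'
  have hmc : (m : ℂ) = 1 / (8 * κ ^ 2 * ε ^ 3) - p := by
    rw [eq_sub_iff_add_eq]; exact_mod_cast hm
  refine ⟨ε * s ^ 2 / 2 - s * z + z ^ 2 / (4 * ε) - z / (4 * κ * ε ^ 2) +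
    m * Complex.log (1 + y) - (z ^ 3 / 3 - s * z), ?_, ?_⟩
  · have e : (1 + y) ^ m = Complex.exp (m * Complex.log (1 + y)) := by
      rw [Complex.exp_nat_mul, Complex.exp_log hne]
    rw [hermiteKernel, ← hy, e, airyKernel, ← Complex.exp_add, ← Complex.exp_add,
      ← Complex.exp_add]
    congr 1; ring
  · have e : ε * s ^ 2 / 2 - s * z + z ^ 2 / (4 * ε) - z / (4 * κ * ε ^ 2) +
        m * Complex.log (1 + y) - (z ^ 3 / 3 - s * z) - kernelCorrection p ε s z =
        -(((1 - κ) / 3 : ℝ) : ℂ) * z ^ 3 + ((ε * (1 - κ ^ 2) / 2 : ℝ) : ℂ) * z ^ 4 +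
        ((2 * p * ε * (1 - κ) : ℝ) : ℂ) * z + ((1 / (8 * κ ^ 2 * ε ^ 3) : ℝ) : ℂ) * r5
        - (p : ℂ) * r2 := by
      rw [hmc, hr2', hr5', kernelCorrection]
      generalize Complex.log (1 + y) = l
      rw [hy]
      push_cast
      field_simp
      ring
    rw [e]
    have hk1 : 0 ≤ 1 - κ := by linarith
    have hε3 : ε ^ 3 ≤ ε ^ 2 := pow_le_pow_of_le_one hε.le (by linarith) (by norm_num)
    have hk2 : 1 - κ ≤ 2 * ε ^ 2 := by linarith
    have hz3 : ‖z‖ ^ 3 ≤ ‖z‖ ^ 5 := pow_le_pow_right₀ hz1 (by norm_num)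
    have hz4 : ‖z‖ ^ 4 ≤ ‖z‖ ^ 5 := pow_le_pow_right₀ hz1 (by norm_num)
    have hz2 : ‖z‖ ^ 2 ≤ ‖z‖ ^ 5 := pow_le_pow_right₀ hz1 (by norm_num)
    have hz1' : ‖z‖ ≤ ‖z‖ ^ 5 := le_self_pow₀ hz1 (by norm_num)
    have hκ2 : κ ^ 2 ≤ 1 := pow_le_one₀ hκ0.le hκ'
    have hκ3 : κ ^ 3 ≤ 1 := pow_le_one₀ hκ0.le hκ'
    have b1 : ‖-(((1 - κ) / 3 : ℝ) : ℂ) * z ^ 3‖ ≤ ε ^ 2 * ‖z‖ ^ 5 := by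
      rw [norm_mul, norm_neg, Complex.norm_real, norm_pow, Real.norm_of_nonneg (by positivity)]
      gcongr; linarith [sq_nonneg ε]
    have b2 : ‖((ε * (1 - κ ^ 2) / 2 : ℝ) : ℂ) * z ^ 4‖ ≤ 2 * ε ^ 2 * ‖z‖ ^ 5 := by
      have : 0 ≤ 1 - κ ^ 2 := by linarith
      rw [norm_mul, Complex.norm_real, norm_pow, Real.norm_of_nonneg (by positivity)]
      gcongr
      nlinarith [sq_nonneg ε, mul_nonneg hk1 hk1]
    have b3 : ‖((2 * p * ε * (1 - κ) : ℝ) : ℂ) * z‖ ≤ 8 * ε ^ 2 * ‖z‖ ^ 5 := by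
      rw [norm_mul, Complex.norm_real, Real.norm_of_nonneg (by positivity)]
      refine mul_le_mul ?_ hz1' (norm_nonneg _) (by positivity)
      calc 2 * p * ε * (1 - κ) ≤ 2 * 2 * 1 * (2 * ε ^ 2) := by gcongr; linarith
        _ = _ := by ring
    have b4 : ‖((1 / (8 * κ ^ 2 * ε ^ 3) : ℝ) : ℂ) * r5‖ ≤ 4 * ε ^ 2 * ‖z‖ ^ 5 := by
      rw [norm_mul, Complex.norm_real, Real.norm_of_nonneg (by positivity)]
      calc 1 / (8 * κ ^ 2 * ε ^ 3) * ‖r5‖ ≤ 1 / (8 * κ ^ 2 * ε ^ 3) * ‖y‖ ^ 5 := by gcongr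
        _ = κ ^ 3 * (4 * ε ^ 2 * ‖z‖ ^ 5) := by rw [hyn]; field_simp; ring
        _ ≤ 1 * (4 * ε ^ 2 * ‖z‖ ^ 5) := by gcongr
        _ = _ := one_mul _
    have b5 : ‖(p : ℂ) * r2‖ ≤ 8 * ε ^ 2 * ‖z‖ ^ 5 := by
      rw [norm_mul, Complex.norm_real, Real.norm_of_nonneg hp]
      calc p * ‖r2‖ ≤ 2 * ‖y‖ ^ 2 := by gcongr
        _ = κ ^ 2 * (8 * ε ^ 2 * ‖z‖ ^ 2) := by rw [hyn]; ring
        _ ≤ 1 * (8 * ε ^ 2 * ‖z‖ ^ 5) := by gcongr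
        _ = _ := one_mul _
    have hfin : 0 ≤ ε ^ 2 * ‖z‖ ^ 5 := by positivity
    refine (norm_sub_le _ _).trans ?_
    refine (add_le_add_left (norm_add_le _ _) _).trans ?_
    refine (add_le_add_left (add_le_add_left (norm_add_le _ _) _) _).trans ?_
    refine (add_le_add_left (add_le_add_left (add_le_add_left (norm_add_le _ _) _) _) _).trans ?_
    linarith

lemma norm_hermiteKernel_sub_airyKernel_le {m : ℕ} {p ε κ s : ℝ} (hε : 0 < ε) (hε' : ε ≤ 1 / 4)
    (hκ : 1 / 2 ≤ κ) (hκ' : κ ≤ 1) (hκε : 1 - κ ≤ 2 * ε ^ 3) (hp : 0 ≤ p) (hp' : p ≤ 2)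
    (hm : m + p = 1 / (8 * κ ^ 2 * ε ^ 3)) (t : ℝ) :
    ‖hermiteKernel m ε κ s (vline 4 t) -
        airyKernel s (vline 4 t) * (1 + kernelCorrection p ε s (vline 4 t))‖ ≤
      865 * rexp 64 * ε ^ 2 * ((1 + s ^ 2) ^ 2 * rexp (ε * s ^ 2 / 2 - 4 * s)) *
        ((4 + |t|) ^ 10 * rexp (-(1 / 2) * t ^ 2)) := by
  set z := vline 4 t with hz
  have hz0 : 4 ≤ ‖z‖ := by simpa [hz] using Complex.re_le_norm z
  have hz1 : 1 ≤ ‖z‖ := by linarith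
  obtain ⟨δ, hδ, hδ'⟩ := exists_hermiteKernel_eq (s := s) hε hε' hκ hκ' hκε hp hp' hm
    (show 0 ≤ z.re by simp [hz]) hz1
  have hc := norm_kernelCorrection_le (s := s) hε hp hp' hz1
  set c := kernelCorrection p ε s z
  set A := airyKernel s z with hA
  set B := rexp (64 + ε * s ^ 2 / 2 - 4 * s) * rexp (-(1 / 2) * t ^ 2) with hB
  have hm' : (m : ℝ) ≤ 1 / (8 * κ ^ 2 * ε ^ 3) := by linarith
  have hKB : ‖A * Complex.exp δ‖ ≤ B := by
    rw [← hδ]; exact norm_hermiteKernel_le_near hε hε' hκ hκ' hm' t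
  have hAB : ‖A‖ ≤ B := by
    rw [hA, hz, norm_airyKernel_vline, hB, ← Real.exp_add, ← Real.exp_add]
    refine Real.exp_le_exp.mpr ?_
    have : 0 ≤ ε * s ^ 2 / 2 := by positivity
    nlinarith [sq_nonneg t]
  have hmax : ‖A‖ * max 1 ‖Complex.exp δ‖ ≤ B := by
    rw [mul_max_of_nonneg _ _ (norm_nonneg _), mul_one, ← norm_mul]
    exact max_le hAB hKB
  have hq : 1 ≤ (1 + s ^ 2) := by linarith [sq_nonneg s]
  have hδn : ‖δ‖ ≤ 29 * ε * ((1 + s ^ 2) * ‖z‖ ^ 5) := by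
    have h1 : ‖δ‖ ≤ ‖δ - c‖ + ‖c‖ := by simpa using norm_add_le (δ - c) c
    have h2 : ε ^ 2 ≤ ε := by nlinarith
    have h3 : 24 * ε ^ 2 * ‖z‖ ^ 5 ≤ 24 * ε * ((1 + s ^ 2) * ‖z‖ ^ 5) := by
      gcongr
      exact le_mul_of_one_le_left (by positivity) hq
    linarith
  have e : A * Complex.exp δ - A * (1 + c) =
      A * (Complex.exp δ - 1 - δ) + A * (δ - c) := by ring
  have hq2 : 1 ≤ (1 + s ^ 2) ^ 2 := one_le_pow₀ hq
  have hzp : ‖z‖ ^ 5 ≤ ‖z‖ ^ 10 := pow_le_pow_right₀ hz1 (by norm_num)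
  have hzt : ‖z‖ ≤ 4 + |t| := by simpa using norm_vline_le 4 t
  have hB0 : 0 ≤ B := by positivity
  calc ‖hermiteKernel m ε κ s z - A * (1 + c)‖
      = ‖A * (Complex.exp δ - 1 - δ) + A * (δ - c)‖ := by rw [hδ, e]
    _ ≤ ‖A‖ * (‖δ‖ ^ 2 * max 1 ‖Complex.exp δ‖) + ‖A‖ * ‖δ - c‖ := by
        refine (norm_add_le _ _).trans ?_
        rw [norm_mul, norm_mul]
        gcongr
        exact norm_exp_sub_one_sub_le δ
    _ = ‖δ‖ ^ 2 * (‖A‖ * max 1 ‖Complex.exp δ‖) + ‖A‖ * ‖δ - c‖ := by ring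
    _ ≤ (29 * ε * ((1 + s ^ 2) * ‖z‖ ^ 5)) ^ 2 * B + B * (24 * ε ^ 2 * ‖z‖ ^ 5) := by gcongr
    _ ≤ (29 * ε * ((1 + s ^ 2) * ‖z‖ ^ 5)) ^ 2 * B +
        B * (24 * ε ^ 2 * ((1 + s ^ 2) ^ 2 * ‖z‖ ^ 10)) := by
        gcongr
        exact hzp.trans (le_mul_of_one_le_left (by positivity) hq2)
    _ = 865 * ε ^ 2 * (1 + s ^ 2) ^ 2 * ‖z‖ ^ 10 * B := by ring
    _ ≤ 865 * ε ^ 2 * (1 + s ^ 2) ^ 2 * (4 + |t|) ^ 10 * B := by gcongr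
    _ = _ := by
        rw [hB, show 64 + ε * s ^ 2 / 2 - 4 * s = 64 + (ε * s ^ 2 / 2 - 4 * s) by ring,
          Real.exp_add]
        ring

/-- Normalized contour integral of `hermiteKernel` along `Re z = b`. -/
noncomputable def hermiteIntegral (m : ℕ) (ε κ s b : ℝ) : ℂ :=
  (2 * π : ℂ)⁻¹ * ∫ t, hermiteKernel m ε κ s (vline b t)

lemma norm_two_pi_inv_mul_le (z : ℂ) : ‖(2 * π : ℂ)⁻¹ * z‖ ≤ ‖z‖ := by
  have e : (2 * π : ℂ) = ((2 * π : ℝ) : ℂ) := by push_cast; rfl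
  rw [norm_mul, norm_inv, e, Complex.norm_real, Real.norm_of_nonneg (by positivity)]
  refine mul_le_of_le_one_left (norm_nonneg _) (inv_le_one_of_one_le₀ ?_)
  linarith [Real.pi_gt_three]

lemma integral_airyKernel_mul_correction (p ε s : ℝ) :
    Integrable (fun t : ℝ => airyKernel s (vline 4 t) * (1 + kernelCorrection p ε s (vline 4 t))) ∧
    (2 * π : ℂ)⁻¹ * ∫ t, airyKernel s (vline 4 t) * (1 + kernelCorrection p ε s (vline 4 t)) =
      ((Ai s + (2 * p - 1) * ε * deriv Ai s : ℝ) : ℂ) := by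
  have i0 := integrable_pow_mul_airyKernel four_pos 0 s
  have i1 := integrable_pow_mul_airyKernel four_pos 1 s
  have i4 := integrable_pow_mul_airyKernel four_pos 4 s
  have iA : Integrable fun t : ℝ => airyKernel s (vline 4 t) := by simpa using i0
  have iQ : Integrable fun t : ℝ =>
      (2 * vline 4 t + vline 4 t ^ 4 - s ^ 2) * airyKernel s (vline 4 t) := by
    refine (((i1.const_mul 2).add i4).sub (i0.const_mul ((s : ℂ) ^ 2))).congr
      (.of_forall fun t => ?_)
    simp; ring
  have iD : Integrable fun t : ℝ => -vline 4 t * airyKernel s (vline 4 t) := by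
    simpa using i1.neg
  have e : ∀ t : ℝ, airyKernel s (vline 4 t) * (1 + kernelCorrection p ε s (vline 4 t)) =
      airyKernel s (vline 4 t) + (-(ε : ℂ) / 2) *
        ((2 * vline 4 t + vline 4 t ^ 4 - s ^ 2) * airyKernel s (vline 4 t)) +
        ((2 * p - 1) * ε : ℂ) * (-vline 4 t * airyKernel s (vline 4 t)) := by
    intro t; rw [kernelCorrection]; ring
  simp_rw [e]
  have iAQ : Integrable fun t : ℝ => airyKernel s (vline 4 t) + (-(ε : ℂ) / 2) *
      ((2 * vline 4 t + vline 4 t ^ 4 - s ^ 2) * airyKernel s (vline 4 t)) :=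
    iA.add (iQ.const_mul _)
  refine ⟨iAQ.add (iD.const_mul ((2 * p - 1) * ε : ℂ)), ?_⟩
  rw [integral_add iAQ (iD.const_mul _), integral_add iA (iQ.const_mul _), integral_const_mul,
    integral_const_mul, integral_airyKernel_quartic four_pos]
  push_cast
  rw [(hasDerivAt_Ai four_pos s).2, Ai_eq_integral four_pos s]
  ring

lemma exists_norm_hermiteIntegral_sub_le : ∃ C > 0, ∀ (m : ℕ) (p ε κ s : ℝ), 0 < ε → ε ≤ 1 / 4 →
    1 / 2 ≤ κ → κ ≤ 1 → 1 - κ ≤ 2 * ε ^ 3 → 0 ≤ p → p ≤ 2 →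
    m + p = 1 / (8 * κ ^ 2 * ε ^ 3) →
    ‖hermiteIntegral m ε κ s 4 - ((Ai s + (2 * p - 1) * ε * deriv Ai s : ℝ) : ℂ)‖ ≤
      C * ε ^ 2 * ((1 + s ^ 2) ^ 2 * rexp (ε * s ^ 2 / 2 - 4 * s)) := by
  have hI := integrable_pow_mul_gaussian (A := 4) (c := 1 / 2) (by norm_num) (by norm_num) 10
  set M := ∫ t : ℝ, (4 + |t|) ^ 10 * rexp (-(1 / 2) * t ^ 2) with hM
  have hM0 : 0 ≤ M := integral_nonneg fun t => by positivity
  refine ⟨865 * rexp 64 * (M + 1), by positivity, ?_⟩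
  intro m p ε κ s hε hε' hκ hκ' hκε hp hp' hm
  have hm' : (m : ℝ) ≤ 1 / (8 * κ ^ 2 * ε ^ 3) := by linarith
  obtain ⟨i1, h1⟩ := integral_airyKernel_mul_correction p ε s
  have i2 : Integrable fun t : ℝ => hermiteKernel m ε κ s (vline 4 t) :=
    ((integrable_exp_neg_mul_sq (by norm_num : (0 : ℝ) < 1 / 2)).const_mul _).mono'
      (by fun_prop) (.of_forall fun t => norm_hermiteKernel_le_near hε hε' hκ hκ' hm' t)
  rw [hermiteIntegral, ← h1, ← mul_sub, ← integral_sub i2 i1]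
  refine (norm_two_pi_inv_mul_le _).trans ?_
  refine (norm_integral_le_of_norm_le (hI.const_mul _) (.of_forall fun t =>
    norm_hermiteKernel_sub_airyKernel_le hε hε' hκ hκ' hκε hp hp' hm t)).trans ?_
  rw [integral_const_mul, ← hM]
  have : 0 ≤ 865 * rexp 64 * ε ^ 2 * ((1 + s ^ 2) ^ 2 * rexp (ε * s ^ 2 / 2 - 4 * s)) := by
    positivity
  nlinarith

lemma norm_hermiteIntegral_far_le {m : ℕ} {ε κ s : ℝ} (hε : 0 < ε) (hε' : ε ≤ 1 / 4)
    (hκ : 1 / 2 ≤ κ) (hm : m ≤ 1 / (8 * κ ^ 2 * ε ^ 3)) (hs : 4 ≤ ε * s) :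
    ‖hermiteIntegral m ε κ s (ε * s)‖ ≤ √(2 * π) * rexp (-s) := by
  refine (norm_two_pi_inv_mul_le _).trans ?_
  refine (norm_integral_le_of_norm_le ((integrable_exp_neg_mul_sq
    (by norm_num : (0 : ℝ) < 1 / 2)).const_mul _)
    (.of_forall fun t => norm_hermiteKernel_le_far hε hε' hκ hm hs t)).trans ?_
  rw [integral_const_mul, integral_gaussian, show π / (1 / 2) = 2 * π by ring, mul_comm]
  gcongr
  have hs0 : 0 < s := pos_of_mul_pos_right (by linarith) hε.le
  nlinarith

lemma exists_abs_Ai_le : ∃ C > 0, ∀ s : ℝ,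
    |Ai s| ≤ C * rexp (-4 * s) ∧ |deriv Ai s| ≤ C * rexp (-4 * s) := by
  have hI := integrable_pow_mul_gaussian (A := 4) (c := 4) (by norm_num) (by norm_num) 1
  set M := ∫ t : ℝ, (4 + |t|) ^ 1 * rexp (-4 * t ^ 2) with hM
  have hM0 : 0 ≤ M := integral_nonneg fun t => by positivity
  refine ⟨rexp (64 / 3) * (M + 1), by positivity, fun s => ?_⟩
  have hK : ∀ t : ℝ, ‖airyKernel s (vline 4 t)‖ =
      rexp (64 / 3) * rexp (-4 * s) * rexp (-4 * t ^ 2) := by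
    intro t
    rw [norm_airyKernel_vline, ← Real.exp_add (64 / 3)]
    ring_nf
  have hle : rexp (64 / 3) * rexp (-4 * s) * M ≤ rexp (64 / 3) * (M + 1) * rexp (-4 * s) := by
    nlinarith [mul_pos (Real.exp_pos (64 / 3)) (Real.exp_pos (-4 * s))]
  have key : ∀ f : ℝ → ℂ, (∀ t, ‖f t‖ ≤ 4 + |t|) →
      ‖(2 * π : ℂ)⁻¹ * ∫ t, f t * airyKernel s (vline 4 t)‖ ≤
        rexp (64 / 3) * (M + 1) * rexp (-4 * s) := by
    intro f hf
    refine (norm_two_pi_inv_mul_le _).trans (le_trans ?_ hle)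
    rw [hM, ← integral_const_mul]
    refine norm_integral_le_of_norm_le (hI.const_mul _) (.of_forall fun t => ?_)
    rw [norm_mul, hK, pow_one]
    calc ‖f t‖ * (rexp (64 / 3) * rexp (-4 * s) * rexp (-4 * t ^ 2))
        ≤ (4 + |t|) * (rexp (64 / 3) * rexp (-4 * s) * rexp (-4 * t ^ 2)) := by
          gcongr; exact hf t
      _ = _ := by ring
  constructor
  · have h := key (fun _ => 1) (fun t => by simp; linarith [abs_nonneg t])
    simp only [one_mul] at h
    rwa [← Ai_eq_integral four_pos, Complex.norm_real] at h
  · have h := key (fun t => -vline 4 t) (fun t => by simpa using norm_vline_le 4 t)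
    rwa [← (hasDerivAt_Ai four_pos s).2, Complex.norm_real] at h

lemma exists_weight_le (sL : ℝ) : ∃ C > 0, ∀ ε s : ℝ, 0 < ε → ε ≤ 1 / 4 → sL ≤ s → ε * s ≤ 4 →
    (1 + s ^ 2) ^ 2 * rexp (ε * s ^ 2 / 2 - 4 * s) ≤ C * rexp (-s) := by
  refine ⟨24 * rexp (1 + 4 * |sL| + sL ^ 2), by positivity, fun ε s hε hε' hs hεs => ?_⟩
  have hsL : -|sL| ≤ s := (neg_abs_le sL).trans hs
  have habs : |s| ≤ s + 2 * |sL| := by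
    rcases abs_cases s with h | h <;> linarith [abs_nonneg sL]
  have h1 : (1 + s ^ 2) ^ 2 ≤ 24 * rexp (1 + |s|) := by
    have h := Real.pow_div_factorial_le_exp (1 + |s|) (by positivity) 4
    rw [div_le_iff₀ (by positivity)] at h
    have h2 : (1 + s ^ 2) ^ 2 ≤ (1 + |s|) ^ 4 := by
      rw [show (1 + |s|) ^ 4 = ((1 + |s|) ^ 2) ^ 2 by ring]
      gcongr
      rw [← sq_abs s]
      nlinarith [abs_nonneg s]
    norm_num [Nat.factorial] at h
    linarith
  have h2 : ε * s ^ 2 / 2 - 4 * s ≤ -2 * s + 2 * |sL| + sL ^ 2 := by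
    rcases le_total 0 s with h0 | h0
    · nlinarith [abs_nonneg sL, sq_nonneg sL]
    · have h3 : s ^ 2 ≤ sL ^ 2 := by nlinarith
      nlinarith [sq_nonneg s]
  calc (1 + s ^ 2) ^ 2 * rexp (ε * s ^ 2 / 2 - 4 * s)
      ≤ (24 * rexp (1 + |s|)) * rexp (-2 * s + 2 * |sL| + sL ^ 2) := by gcongr
    _ = 24 * rexp ((1 + |s|) + (-2 * s + 2 * |sL| + sL ^ 2)) := by
          rw [mul_assoc, ← Real.exp_add]
    _ ≤ 24 * rexp ((1 + 4 * |sL| + sL ^ 2) + -s) :=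
          mul_le_mul_of_nonneg_left (Real.exp_le_exp.mpr (by linarith)) (by norm_num)
    _ = _ := by rw [Real.exp_add]; ring

/-- Uniform Airy approximation of the rescaled Hermite contour integral on `[sL, ∞)`. -/
lemma exists_hermiteIntegral_bounds (sL : ℝ) : ∃ C > 0, ∀ (m : ℕ) (p ε κ s : ℝ), 0 < ε →
    ε ≤ 1 / 4 → 1 / 2 ≤ κ → κ ≤ 1 → 1 - κ ≤ 2 * ε ^ 3 → 0 ≤ p → p ≤ 2 →
    m + p = 1 / (8 * κ ^ 2 * ε ^ 3) → sL ≤ s → ∃ b : ℝ,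
    ‖hermiteIntegral m ε κ s b‖ ≤ C * rexp (-s) ∧
    ‖hermiteIntegral m ε κ s b - ((Ai s + (2 * p - 1) * ε * deriv Ai s : ℝ) : ℂ)‖ ≤
      C * ε ^ 2 * rexp (-s / 2) := by
  obtain ⟨C₁, hC₁, H₁⟩ := exists_norm_hermiteIntegral_sub_le
  obtain ⟨C₂, hC₂, H₂⟩ := exists_abs_Ai_le
  obtain ⟨C₃, hC₃, H₃⟩ := exists_weight_le sL
  set D := C₂ * rexp (3 * |sL|) with hD
  have hD0 : 0 < D := by positivity
  refine ⟨C₁ * C₃ * rexp (|sL| / 2) + C₁ * C₃ + 4 * D + √(2 * π), by positivity, ?_⟩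
  intro m p ε κ s hε hε' hκ hκ' hκε hp hp' hm hs
  have hsL : -|sL| ≤ s := (neg_abs_le sL).trans hs
  have hexp : rexp (-4 * s) ≤ rexp (3 * |sL|) * rexp (-s) := by
    rw [← Real.exp_add]; exact Real.exp_le_exp.mpr (by linarith)
  have hA : |Ai s| ≤ D * rexp (-s) := by
    refine (H₂ s).1.trans ?_
    rw [hD, mul_assoc]; gcongr
  have hA' : |deriv Ai s| ≤ D * rexp (-s) := by
    refine (H₂ s).2.trans ?_
    rw [hD, mul_assoc]; gcongr
  have hlim : ‖((Ai s + (2 * p - 1) * ε * deriv Ai s : ℝ) : ℂ)‖ ≤ 4 * D * rexp (-s) := by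
    rw [Complex.norm_real, Real.norm_eq_abs]
    have h1 : |(2 * p - 1) * ε| ≤ 3 := by
      rw [abs_le]; constructor <;> nlinarith
    calc |Ai s + (2 * p - 1) * ε * deriv Ai s|
        ≤ |Ai s| + |(2 * p - 1) * ε| * |deriv Ai s| := by
          rw [← abs_mul]; exact abs_add_le _ _
      _ ≤ D * rexp (-s) + 3 * (D * rexp (-s)) := by gcongr
      _ = _ := by ring
  have hε2 : ε ^ 2 ≤ 1 := by nlinarith
  have hes := Real.exp_pos (-s)
  have hes2 := Real.exp_pos (-s / 2)
  have hr := Real.exp_pos (|sL| / 2)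
  have hsq := Real.sqrt_nonneg (2 * π)
  have hCC : 0 < C₁ * C₃ := by positivity
  rcases le_total (ε * s) 4 with h4 | h4
  · refine ⟨4, ?_⟩
    have h1 : ‖hermiteIntegral m ε κ s 4 - ((Ai s + (2 * p - 1) * ε * deriv Ai s : ℝ) : ℂ)‖ ≤
        C₁ * C₃ * ε ^ 2 * rexp (-s) := by
      refine (H₁ m p ε κ s hε hε' hκ hκ' hκε hp hp' hm).trans ?_
      calc C₁ * ε ^ 2 * ((1 + s ^ 2) ^ 2 * rexp (ε * s ^ 2 / 2 - 4 * s))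
          ≤ C₁ * ε ^ 2 * (C₃ * rexp (-s)) :=
            mul_le_mul_of_nonneg_left (H₃ ε s hε hε' hs h4) (by positivity)
        _ = _ := by ring
    constructor
    · calc ‖hermiteIntegral m ε κ s 4‖
          ≤ ‖hermiteIntegral m ε κ s 4 - ((Ai s + (2 * p - 1) * ε * deriv Ai s : ℝ) : ℂ)‖ +
            ‖((Ai s + (2 * p - 1) * ε * deriv Ai s : ℝ) : ℂ)‖ := by
            have h := norm_add_le (hermiteIntegral m ε κ s 4 -
              ((Ai s + (2 * p - 1) * ε * deriv Ai s : ℝ) : ℂ))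
              ((Ai s + (2 * p - 1) * ε * deriv Ai s : ℝ) : ℂ)
            rwa [sub_add_cancel] at h
        _ ≤ C₁ * C₃ * 1 * rexp (-s) + 4 * D * rexp (-s) := by
            refine add_le_add (h1.trans ?_) hlim
            gcongr
        _ = (C₁ * C₃ + 4 * D) * rexp (-s) := by ring
        _ ≤ _ := mul_le_mul_of_nonneg_right (by linarith [mul_pos hCC hr]) hes.le
    · refine h1.trans ?_
      have h2 : rexp (-s) ≤ rexp (|sL| / 2) * rexp (-s / 2) := by
        rw [← Real.exp_add]; exact Real.exp_le_exp.mpr (by linarith)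
      calc C₁ * C₃ * ε ^ 2 * rexp (-s)
          ≤ C₁ * C₃ * ε ^ 2 * (rexp (|sL| / 2) * rexp (-s / 2)) := by gcongr
        _ = C₁ * C₃ * rexp (|sL| / 2) * ε ^ 2 * rexp (-s / 2) := by ring
        _ ≤ _ := mul_le_mul_of_nonneg_right (mul_le_mul_of_nonneg_right (by linarith)
            (sq_nonneg ε)) hes2.le
  · refine ⟨ε * s, ?_⟩
    have hm' : (m : ℝ) ≤ 1 / (8 * κ ^ 2 * ε ^ 3) := by linarith
    have h1 := norm_hermiteIntegral_far_le hε hε' hκ hm' h4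
    constructor
    · exact h1.trans (mul_le_mul_of_nonneg_right (by linarith [mul_pos hCC hr]) hes.le)
    · have h2 : rexp (-s) ≤ ε ^ 2 * rexp (-s / 2) := by
        have h3 : rexp (-s / 2) ≤ ε ^ 2 := by
          have h5 : 2 / ε ≤ s / 2 := by
            rw [div_le_iff₀ hε]; linarith
          have h6 := Real.pow_div_factorial_le_exp (2 / ε) (by positivity) 2
          have h7 : (ε ^ 2)⁻¹ ≤ rexp (s / 2) := by
            refine le_trans (le_trans ?_ h6) (Real.exp_le_exp.mpr h5)
            rw [div_pow, inv_eq_one_div]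
            norm_num [Nat.factorial]
            rw [← mul_one (ε ^ 2)⁻¹]
            rw [div_div, div_eq_mul_inv, mul_inv]
            nlinarith [inv_pos.mpr (pow_pos hε 2)]
          rw [neg_div, Real.exp_neg]
          exact inv_le_of_inv_le₀ (by positivity) h7
        calc rexp (-s) = rexp (-s / 2) * rexp (-s / 2) := by rw [← Real.exp_add]; ring_nf
          _ ≤ _ := by gcongr
      calc ‖hermiteIntegral m ε κ s (ε * s) - ((Ai s + (2 * p - 1) * ε * deriv Ai s : ℝ) : ℂ)‖
          ≤ √(2 * π) * rexp (-s) + 4 * D * rexp (-s) :=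
            (norm_sub_le _ _).trans (add_le_add h1 hlim)
        _ = (√(2 * π) + 4 * D) * rexp (-s) := by ring
        _ ≤ (√(2 * π) + 4 * D) * (ε ^ 2 * rexp (-s / 2)) := by gcongr
        _ = (√(2 * π) + 4 * D) * ε ^ 2 * rexp (-s / 2) := by ring
        _ ≤ _ := mul_le_mul_of_nonneg_right (mul_le_mul_of_nonneg_right
            (by linarith [mul_pos hCC hr]) (sq_nonneg ε)) hes2.le

lemma mul_exp_eq_hermiteKernel (m : ℕ) {τ κ : ℝ} (hτ : 0 < τ) (hκ : 0 < κ) (s : ℝ) (z : ℂ) :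
    ((1 / (2 * τ ^ 3 * κ) : ℝ) + z / τ) ^ m *
      Complex.exp (((1 / (2 * τ ^ 3 * κ) : ℝ) + z / τ) ^ 2 / 4 -
        ((1 / (2 * τ ^ 3 * κ) : ℝ) + z / τ) * ((1 / (2 * τ ^ 3 * κ) + τ * s : ℝ) : ℂ) +
        ((1 / (2 * τ ^ 3 * κ) + τ * s : ℝ) : ℂ) ^ 2 / 2) =
    (((1 / (2 * τ ^ 3 * κ)) ^ m * rexp (-(1 / (2 * τ ^ 3 * κ)) ^ 2 / 4) : ℝ) : ℂ) *
      hermiteKernel m (τ ^ 2) κ s z := by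
  have hτc : (τ : ℂ) ≠ 0 := by exact_mod_cast hτ.ne'
  have hκc : (κ : ℂ) ≠ 0 := by exact_mod_cast hκ.ne'
  have e1 : ((1 / (2 * τ ^ 3 * κ) : ℝ) + z / τ : ℂ) =
      ((1 / (2 * τ ^ 3 * κ) : ℝ) : ℂ) * (1 + 2 * κ * (τ ^ 2 : ℝ) * z) := by
    push_cast; field_simp
  have e2 : ((1 / (2 * τ ^ 3 * κ) : ℝ) + z / τ : ℂ) ^ 2 / 4 -
        ((1 / (2 * τ ^ 3 * κ) : ℝ) + z / τ) * ((1 / (2 * τ ^ 3 * κ) + τ * s : ℝ) : ℂ) +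
        ((1 / (2 * τ ^ 3 * κ) + τ * s : ℝ) : ℂ) ^ 2 / 2 =
      ((-(1 / (2 * τ ^ 3 * κ)) ^ 2 / 4 : ℝ) : ℂ) + ((τ ^ 2 : ℝ) * s ^ 2 / 2 - s * z +
        z ^ 2 / (4 * (τ ^ 2 : ℝ)) - z / (4 * κ * (τ ^ 2 : ℝ) ^ 2)) := by
    push_cast; field_simp; ring
  rw [e2, Complex.exp_add, e1, mul_pow, hermiteKernel]
  push_cast
  ring

lemma osc_eq_hermiteIntegral (m : ℕ) {τ κ : ℝ} (hτ : 0 < τ) (hκ : 0 < κ) (s b : ℝ) :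
    ((osc m (1 / (2 * τ ^ 3 * κ) + τ * s) : ℝ) : ℂ) =
      ((hNorm m ^ (-(1 : ℝ) / 2) * √π * (1 / (2 * τ ^ 3 * κ)) ^ m *
        rexp (-(1 / (2 * τ ^ 3 * κ)) ^ 2 / 4) / τ : ℝ) : ℂ) *
      hermiteIntegral m (τ ^ 2) κ s b := by
  have hμ := mul_exp_eq_hermiteKernel m hτ hκ s
  have hτc : (τ : ℂ) ≠ 0 := by exact_mod_cast hτ.ne'
  generalize 1 / (2 * τ ^ 3 * κ) = μ at hμ ⊢
  have hx : ((rexp (-(μ + τ * s) ^ 2 / 2) * rexp ((μ + τ * s) ^ 2) : ℝ) : ℂ) =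
      Complex.exp (((μ + τ * s : ℝ) : ℂ) ^ 2 / 2) := by
    rw [← Real.exp_add, Complex.ofReal_exp]; congr 1; push_cast; ring
  have hInt : ∫ t, (-vline (μ + b / τ) t) ^ m * Complex.exp (vline (μ + b / τ) t ^ 2 / 4) *
        Complex.exp (-vline (μ + b / τ) t * ((μ + τ * s : ℝ) : ℂ)) =
      (τ : ℂ)⁻¹ * ∫ t : ℝ, (-(μ + vline b t / τ)) ^ m *
        Complex.exp ((μ + vline b t / τ) ^ 2 / 4) *
        Complex.exp (-(μ + vline b t / τ) * ((μ + τ * s : ℝ) : ℂ)) := by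
    have hv : ∀ t : ℝ, (μ + vline b t / τ : ℂ) = vline (μ + b / τ) (t / τ) := by
      intro t; rw [vline, vline]; push_cast; ring
    simp_rw [hv]
    rw [Measure.integral_comp_div (fun t => (-vline (μ + b / τ) t) ^ m *
      Complex.exp (vline (μ + b / τ) t ^ 2 / 4) *
        Complex.exp (-vline (μ + b / τ) t * ((μ + τ * s : ℝ) : ℂ))) τ, abs_of_pos hτ,
      Complex.real_smul, inv_mul_cancel_left₀ hτc]
  have hker : ∀ t : ℝ, (-1 : ℂ) ^ m * Complex.exp (((μ + τ * s : ℝ) : ℂ) ^ 2 / 2) *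
      ((-(μ + vline b t / τ)) ^ m * Complex.exp ((μ + vline b t / τ) ^ 2 / 4) *
        Complex.exp (-(μ + vline b t / τ) * ((μ + τ * s : ℝ) : ℂ))) =
      ((μ ^ m * rexp (-μ ^ 2 / 4) : ℝ) : ℂ) * hermiteKernel m (τ ^ 2) κ s (vline b t) := by
    intro t
    rw [← hμ, sub_add_eq_add_sub, sub_eq_add_neg, ← neg_mul, Complex.exp_add, Complex.exp_add,
      neg_pow (μ + vline b t / τ : ℂ)]
    have : (-1 : ℂ) ^ m * (-1) ^ m = 1 := by rw [← mul_pow]; simp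
    linear_combination (Complex.exp (((μ + τ * s : ℝ) : ℂ) ^ 2 / 2) * ((μ + vline b t / τ) ^ m *
      Complex.exp ((μ + vline b t / τ) ^ 2 / 4) *
        Complex.exp (-(μ + vline b t / τ) * ((μ + τ * s : ℝ) : ℂ)))) * this
  have hπ : ((√π : ℝ) : ℂ) * √π = π := by
    rw [← Complex.ofReal_mul, Real.mul_self_sqrt pi_pos.le]
  have hπ0 : ((√π : ℝ) : ℂ) ≠ 0 := by exact_mod_cast (Real.sqrt_pos.mpr pi_pos).ne'
  calc ((osc m (μ + τ * s) : ℝ) : ℂ)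
      = ((hNorm m ^ (-(1 : ℝ) / 2) : ℝ) : ℂ) * ((2 * √π : ℝ)⁻¹ : ℝ) * (τ : ℂ)⁻¹ *
        ∫ t : ℝ, (-1 : ℂ) ^ m * Complex.exp (((μ + τ * s : ℝ) : ℂ) ^ 2 / 2) *
        ((-(μ + vline b t / τ)) ^ m * Complex.exp ((μ + vline b t / τ) ^ 2 / 4) *
        Complex.exp (-(μ + vline b t / τ) * ((μ + τ * s : ℝ) : ℂ))) := by
        rw [integral_const_mul, ← hx, osc, physHermite, Complex.ofReal_mul, Complex.ofReal_mul,
          Complex.ofReal_mul, iteratedDeriv_gaussian_eq_integral m (μ + b / τ), hInt]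
        push_cast
        ring
    _ = _ := by
        simp_rw [hker]
        rw [integral_const_mul, hermiteIntegral]
        push_cast
        rw [← hπ]
        field_simp

lemma log_stirlingSeq_le {n : ℕ} (hn : n ≠ 0) :
    Real.log (Stirling.stirlingSeq n) ≤ Real.log √π + 1 / (12 * n) := by
  have hmono : Monotone fun k : ℕ => Real.log (Stirling.stirlingSeq (k + 1)) -
      1 / (12 * ((k + 1 : ℕ) : ℝ)) := by
    refine monotone_nat_of_le_succ fun k => ?_
    have h := Stirling.log_stirlingSeq_sdiff_le (k + 1)
    have e : 1 / (12 * ((k + 1 : ℕ) : ℝ) * (((k + 1 : ℕ) : ℝ) + 1)) =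
        1 / (12 * ((k + 1 : ℕ) : ℝ)) - 1 / (12 * ((k + 1 + 1 : ℕ) : ℝ)) := by
      push_cast; field_simp; ring
    linarith
  have hlim : Tendsto (fun k : ℕ => Real.log (Stirling.stirlingSeq (k + 1)) -
      1 / (12 * ((k + 1 : ℕ) : ℝ))) atTop (nhds (Real.log √π - 0)) := by
    refine Tendsto.sub ?_ ?_
    · exact (Stirling.tendsto_stirlingSeq_sqrt_pi.comp (tendsto_add_atTop_nat 1)).log
        (Real.sqrt_pos.mpr pi_pos).ne'
    · have h := (tendsto_one_div_add_atTop_nhds_zero_nat (𝕜 := ℝ)).const_mul (1 / 12)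
      rw [mul_zero] at h
      refine h.congr fun k => ?_
      push_cast; field_simp
  obtain ⟨k, rfl⟩ := Nat.exists_eq_succ_of_ne_zero hn
  have h := hmono.ge_of_tendsto hlim k
  simp only [Nat.succ_eq_add_one] at h ⊢
  linarith

lemma hNorm_pos (n : ℕ) : 0 < hNorm n := by unfold hNorm; positivity

/-- Amplitude of the rescaled oscillator wave function `osc N` relative to the Airy function. -/
noncomputable def oscAmplitude (N : ℕ) : ℝ :=
  (2 * N : ℝ) ^ ((1 : ℝ) / 4) * (hNorm N ^ (-(1 : ℝ) / 2) * √π * √(2 * N + 1) ^ N *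
    rexp (-√(2 * N + 1) ^ 2 / 4))

lemma oscAmplitude_pos {N : ℕ} (hN : N ≠ 0) : 0 < oscAmplitude N := by
  have := hNorm_pos N
  unfold oscAmplitude
  positivity

lemma log_oscAmplitude {N : ℕ} (hN : N ≠ 0) :
    Real.log (oscAmplitude N) = 1 / 2 * (Real.log √π - Real.log (Stirling.stirlingSeq N)) +
      (N * Real.log (1 + 1 / (2 * N)) - 1 / 2) / 2 := by
  have hN0 : (0 : ℝ) < N := by positivity
  have hh := hNorm_pos N
  have h1 : Real.log (hNorm N) = Real.log √π + N * Real.log 2 + Real.log (N.factorial : ℝ) := by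
    rw [hNorm, Real.log_mul (by positivity) (by positivity),
      Real.log_mul (by positivity) (by positivity), Real.log_pow]
  have h2 : Real.log (2 * N + 1 : ℝ) = Real.log (2 * N) + Real.log (1 + 1 / (2 * N)) := by
    rw [← Real.log_mul (by positivity) (by positivity)]
    congr 1; field_simp
  have h3 : Real.log (N / rexp 1) = Real.log N - 1 := by
    rw [Real.log_div (by positivity) (by positivity), Real.log_exp]
  have h4 : Real.log (2 * N : ℝ) = Real.log 2 + Real.log N :=
    Real.log_mul (by positivity) (by positivity)
  rw [oscAmplitude, Real.log_mul (by positivity) (by positivity),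
    Real.log_mul (by positivity) (by positivity), Real.log_mul (by positivity) (by positivity),
    Real.log_mul (by positivity) (by positivity), Real.log_exp, Real.log_pow,
    Real.log_rpow (by positivity), Real.log_rpow hh, h1, Real.sq_sqrt (by positivity),
    Real.log_sqrt (by positivity : (0 : ℝ) ≤ 2 * N + 1), h2, Stirling.log_stirlingSeq_formula,
    h3, h4]
  ring

lemma abs_oscAmplitude_sub_one_le {N : ℕ} (hN : N ≠ 0) : |oscAmplitude N - 1| ≤ 1 / N := by
  have hN0 : (0 : ℝ) < N := by positivity
  have hA := oscAmplitude_pos hN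
  have hlog := log_oscAmplitude hN
  have hs := log_stirlingSeq_le hN
  have hs' : Real.log √π ≤ Real.log (Stirling.stirlingSeq N) :=
    Real.log_le_log (Real.sqrt_pos.mpr pi_pos) (Stirling.sqrt_pi_le_stirlingSeq hN)
  have hu : N * Real.log (1 + 1 / (2 * N)) ≤ 1 / 2 := by
    have h := Real.log_le_sub_one_of_pos (show (0 : ℝ) < 1 + 1 / (2 * N) by positivity)
    calc N * Real.log (1 + 1 / (2 * N)) ≤ N * (1 + 1 / (2 * N) - 1) := by gcongr
      _ = 1 / 2 := by field_simp; ring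
  have hl : 1 / 2 - 1 / N ≤ N * Real.log (1 + 1 / (2 * N)) := by
    have h := Real.le_log_one_add_of_nonneg (show (0 : ℝ) ≤ 1 / (2 * N) by positivity)
    refine le_trans ?_ (mul_le_mul_of_nonneg_left h hN0.le)
    have e : N * (2 * (1 / (2 * N : ℝ)) / (1 / (2 * N) + 2)) - (1 / 2 - 1 / N) =
        (7 * N + 2) / (2 * N * (4 * N + 1)) := by
      field_simp; ring
    have : (0 : ℝ) ≤ (7 * N + 2) / (2 * N * (4 * N + 1)) := by positivity
    linarith
  have h12 : (1 : ℝ) / (12 * N) = 1 / 12 * (1 / N) := by field_simp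
  have hN1 : (0 : ℝ) < 1 / N := by positivity
  have hle : oscAmplitude N ≤ 1 := by
    rw [← Real.log_nonpos_iff hA.le]; linarith
  have hge := Real.log_le_sub_one_of_pos hA
  rw [abs_le]
  constructor <;> linarith

lemma oscAmplitude_mul_eq {N : ℕ} (hN : N ≠ 0) :
    (2 * N : ℝ) ^ ((1 : ℝ) / 4) * (hNorm (N - 1) ^ (-(1 : ℝ) / 2) * √π *
      √(2 * N + 1) ^ (N - 1) * rexp (-√(2 * N + 1) ^ 2 / 4)) =
    oscAmplitude N * (√(2 * N) / √(2 * N + 1)) := by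
  obtain ⟨k, rfl⟩ := Nat.exists_eq_succ_of_ne_zero hN
  have hk := hNorm_pos k
  have h1 : hNorm (k + 1) = hNorm k * (2 * ((k + 1 : ℕ) : ℝ)) := by
    rw [hNorm, hNorm, Nat.factorial_succ]; push_cast; ring
  have h2 : (2 * ((k + 1 : ℕ) : ℝ)) ^ (-(1 : ℝ) / 2) * √(2 * ((k + 1 : ℕ) : ℝ)) = 1 := by
    rw [Real.sqrt_eq_rpow, ← Real.rpow_add (by positivity)]; norm_num
  have h3 : 0 < √(2 * ((k + 1 : ℕ) : ℝ) + 1) := by positivity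
  rw [oscAmplitude, Nat.succ_eq_add_one, h1, Real.mul_rpow hk.le (by positivity),
    Nat.add_sub_cancel, pow_succ]
  generalize √(2 * ((k + 1 : ℕ) : ℝ)) = q at h2 ⊢
  generalize √(2 * ((k + 1 : ℕ) : ℝ) + 1) = u at h3 ⊢
  generalize (2 * ((k + 1 : ℕ) : ℝ)) ^ (-(1 : ℝ) / 2) = r at h2 ⊢
  field_simp
  linear_combination (-(u ^ (k + 1))) * h2

lemma tauN_pos {N : ℕ} (hN : N ≠ 0) : 0 < tauN N := by unfold tauN; positivity

lemma tauN_pow_six (N : ℕ) : tauN N ^ 6 = 1 / (8 * N) := by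
  rw [tauN, mul_pow, ← Real.rpow_natCast, ← Real.rpow_natCast, ← Real.rpow_mul (by positivity),
    ← Real.rpow_mul (by positivity)]
  norm_num [Real.rpow_neg_one, Real.rpow_neg]
  ring

lemma rpow_neg_two_thirds_eq (N : ℕ) : (N : ℝ) ^ (-(2 : ℝ) / 3) = 4 * tauN N ^ 4 := by
  rw [tauN, mul_pow, ← Real.rpow_natCast, ← Real.rpow_natCast, ← Real.rpow_mul (by positivity),
    ← Real.rpow_mul (by positivity)]
  norm_num [Real.rpow_neg]
  ring_nf

lemma two_mul_tauN_pow_three_mul {N : ℕ} (hN : N ≠ 0) : 2 * tauN N ^ 3 * √(2 * N) = 1 := by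
  have hN0 : (0 : ℝ) < N := by positivity
  have hτ := tauN_pos hN
  refine (pow_left_inj₀ (by positivity) zero_le_one two_ne_zero).mp ?_
  rw [mul_pow, Real.sq_sqrt (by positivity), mul_pow, ← pow_mul, tauN_pow_six]
  field_simp; norm_num

lemma tauN_sq_le {N : ℕ} (hN : 8 ≤ N) : tauN N ^ 2 ≤ 1 / 4 := by
  have hN0 : (8 : ℝ) ≤ N := by exact_mod_cast hN
  refine (pow_le_pow_iff_left₀ (by positivity) (by norm_num) three_ne_zero).mp ?_
  rw [← pow_mul, tauN_pow_six, div_le_iff₀ (by positivity)]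
  linarith

lemma abs_DeltaN_sub_le {N : ℕ} (hN : 8 ≤ N) : |DeltaN N - 2 * tauN N ^ 2| ≤ tauN N ^ 4 := by
  have hN0 : (8 : ℝ) ≤ N := by exact_mod_cast hN
  have hτ := tauN_pos (show N ≠ 0 by omega)
  have hq := two_mul_tauN_pow_three_mul (show N ≠ 0 by omega)
  have hτ4 := tauN_sq_le hN
  rw [DeltaN]
  generalize tauN N = τ at *
  have hu2 : √(2 * N + 1 : ℝ) ^ 2 = 2 * N + 1 := Real.sq_sqrt (by positivity)
  have hq2 : √(2 * N : ℝ) ^ 2 = 2 * N := Real.sq_sqrt (by positivity)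
  have hw2 : √(2 * N - 1 : ℝ) ^ 2 = 2 * N - 1 := Real.sq_sqrt (by linarith)
  have hqu : √(2 * N : ℝ) ≤ √(2 * N + 1) := Real.sqrt_le_sqrt (by linarith)
  have hw0 : 0 ≤ √(2 * N - 1 : ℝ) := Real.sqrt_nonneg _
  have hq0 : 0 < √(2 * N : ℝ) := by positivity
  generalize √(2 * N + 1 : ℝ) = u at *
  generalize √(2 * N : ℝ) = q at *
  generalize √(2 * N - 1 : ℝ) = w at *
  have hu0 : 0 < u := hq0.trans_le hqu
  have h1 : u - w = 2 / (u + w) := by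
    rw [eq_div_iff (by positivity)]; linear_combination hu2 - hw2
  have h2 : 2 * q - (u + w) = 2 / ((u + w) * (q + w) * (u + q)) := by
    rw [eq_div_iff (by positivity)]
    linear_combination (u + q) * (u + w) * (hq2 - hw2) - (q + w) * (u + w) * (hu2 - hq2) +
      (hu2 - hw2)
  have h3 : 2 * τ ^ 2 = 1 / (q * τ) := by
    rw [eq_div_iff (by positivity)]; linear_combination hq
  have h4 : (u - w) / τ - 2 * τ ^ 2 = 2 / ((u + w) ^ 2 * (q + w) * (u + q) * (q * τ)) := by
    have : 2 / ((u + w) ^ 2 * (q + w) * (u + q) * (q * τ)) =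
        (2 * q - (u + w)) / ((u + w) * (q * τ)) := by
      rw [h2]; field_simp
    rw [this, h1, h3]; field_simp
  have h5 : 2 / ((u + w) ^ 2 * (q + w) * (u + q) * (q * τ)) ≤
      2 / (q ^ 2 * q * (q + q) * (q * τ)) := by
    gcongr <;> linarith
  have h6 : 2 / (q ^ 2 * q * (q + q) * (q * τ)) = 32 * (τ ^ 2) ^ 5 * τ ^ 4 := by
    have : q = 1 / (2 * τ ^ 3) := by rw [eq_div_iff (by positivity)]; linear_combination hq
    rw [this]; field_simp; norm_num
  have h7 : 32 * (τ ^ 2) ^ 5 * τ ^ 4 ≤ 32 * (1 / 4) ^ 5 * τ ^ 4 := by gcongr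
  rw [h4, abs_of_nonneg (by positivity)]
  have : 0 ≤ τ ^ 4 := by positivity
  linarith

lemma abs_mul_le_of_norm_bounds {X a v ε C E F : ℝ} {J : ℂ} (hX : (X : ℂ) = a * J)
    (ha : |a - 1| ≤ ε ^ 2) (hε : ε ^ 2 ≤ 1) (hJ : ‖J‖ ≤ C * E) (hJv : ‖J - v‖ ≤ C * ε ^ 2 * F) :
    |X| ≤ 2 * C * E ∧ |X - v| ≤ C * ε ^ 2 * (E + F) := by
  have ha2 : |a| ≤ 2 := by
    have := abs_add_le (a - 1) 1
    rw [sub_add_cancel, abs_one] at this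
    linarith
  have hCE : 0 ≤ C * E := (norm_nonneg _).trans hJ
  constructor
  · rw [← Real.norm_eq_abs, ← Complex.norm_real, hX, norm_mul, Complex.norm_real,
      Real.norm_eq_abs, mul_assoc]
    gcongr
  · have e : ((X - v : ℝ) : ℂ) = ((a - 1 : ℝ) : ℂ) * J + (J - v) := by
      push_cast; rw [hX]; ring
    rw [← Real.norm_eq_abs, ← Complex.norm_real, e]
    refine (norm_add_le _ _).trans ?_
    rw [norm_mul, Complex.norm_real, Real.norm_eq_abs]
    have : |a - 1| * ‖J‖ ≤ ε ^ 2 * (C * E) := by gcongr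
    linarith

lemma exists_tauR_bounds (sL : ℝ) : ∃ C > 0, ∀ N : ℕ, 8 ≤ N → ∀ s : ℝ, sL ≤ s →
    (|phiTauR N s| ≤ C * rexp (-s) ∧
      |phiTauR N s - Ai s| ≤ C * tauN N ^ 4 * (rexp (-s) + rexp (-s / 2))) ∧
    (|psiTauR N s| ≤ C * rexp (-s) ∧
      |psiTauR N s - (Ai s + 2 * tauN N ^ 2 * deriv Ai s)| ≤
        C * tauN N ^ 4 * (rexp (-s) + rexp (-s / 2))) := by
  obtain ⟨C, hC, H⟩ := exists_hermiteIntegral_bounds sL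
  refine ⟨4 * C, by positivity, fun N hN s hs => ?_⟩
  have hN0 : N ≠ 0 := by omega
  have hN8 : (8 : ℝ) ≤ N := by exact_mod_cast hN
  have hτ := tauN_pos hN0
  have hq := two_mul_tauN_pow_three_mul hN0
  have hτ4 := tauN_sq_le hN
  have hτ6 := tauN_pow_six N
  have hA := abs_oscAmplitude_sub_one_le hN0
  have hA' := oscAmplitude_mul_eq hN0
  rw [phiTauR, psiTauR]
  have hA'' : oscAmplitude N = (2 * N : ℝ) ^ ((1 : ℝ) / 4) * (hNorm N ^ (-(1 : ℝ) / 2) * √π *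
    √(2 * N + 1) ^ N * rexp (-√(2 * N + 1) ^ 2 / 4)) := rfl
  have hApos := oscAmplitude_pos hN0
  generalize oscAmplitude N = A at *
  generalize tauN N = τ at *
  set κ := √(2 * N) / √(2 * N + 1 : ℝ) with hκ
  have hu0 : 0 < √(2 * N + 1 : ℝ) := by positivity
  have hκ0 : 0 < κ := by positivity
  have hκ2 : κ ^ 2 = 2 * N / (2 * N + 1) := by
    rw [hκ, div_pow, Real.sq_sqrt (by positivity), Real.sq_sqrt (by positivity)]
  have hκ1 : κ ≤ 1 := (div_le_one hu0).mpr (Real.sqrt_le_sqrt (by linarith))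
  have hκN : 1 - κ ≤ 1 / (4 * N) := by
    have h1 : (1 - κ) * (1 + κ) = 1 / (2 * N + 1) := by
      rw [show (1 - κ) * (1 + κ) = 1 - κ ^ 2 by ring, hκ2]; field_simp; ring
    have h2 : 1 + κ ^ 2 = (4 * N + 1) / (2 * N + 1) := by rw [hκ2]; field_simp; ring
    have h3 : (1 - κ) * (1 + κ ^ 2) ≤ 1 / (2 * N + 1) := by
      rw [← h1]
      refine mul_le_mul_of_nonneg_left ?_ (by linarith)
      nlinarith
    rw [h2, mul_div_assoc', div_le_div_iff_of_pos_right (by positivity)] at h3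
    rw [le_div_iff₀ (by positivity)]
    nlinarith
  have hNτ : 1 / (4 * N : ℝ) = 2 * (τ ^ 2) ^ 3 := by
    rw [← pow_mul, hτ6]; field_simp; norm_num
  have hNτ' : 1 / (N : ℝ) = 8 * (τ ^ 2) ^ 3 := by
    rw [← pow_mul, hτ6]; field_simp
  have hκh : 1 / 2 ≤ κ := by
    have : 1 / (4 * N : ℝ) ≤ 1 / 2 := by
      rw [div_le_div_iff₀ (by positivity) (by norm_num)]; linarith
    linarith
  have hμ : √(2 * N + 1 : ℝ) = 1 / (2 * τ ^ 3 * κ) := by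
    rw [eq_div_iff (by positivity), hκ]
    field_simp
    linear_combination hq
  have hM : (N : ℝ) + 1 / 2 = 1 / (8 * κ ^ 2 * (τ ^ 2) ^ 3) := by
    rw [hκ2, ← pow_mul, hτ6]; field_simp
  have hM' : ((N - 1 : ℕ) : ℝ) + 3 / 2 = 1 / (8 * κ ^ 2 * (τ ^ 2) ^ 3) := by
    rw [← hM, Nat.cast_sub (by omega)]; push_cast; ring
  have hτ0 : 0 < τ ^ 2 := by positivity
  have hτc : (τ : ℂ) ≠ 0 := by exact_mod_cast hτ.ne'
  have hcube : 16 * (τ ^ 2) ^ 3 ≤ 4 * (τ ^ 2) ^ 2 := by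
    have : 0 ≤ (τ ^ 2) ^ 2 := by positivity
    nlinarith
  have hsq : (2 * τ ^ 2) ^ 2 ≤ 1 := by nlinarith
  have aux : ∀ (m : ℕ) (p a : ℝ), 0 ≤ p → p ≤ 2 → m + p = 1 / (8 * κ ^ 2 * (τ ^ 2) ^ 3) →
      a = (2 * N : ℝ) ^ ((1 : ℝ) / 4) * (hNorm m ^ (-(1 : ℝ) / 2) * √π * √(2 * N + 1) ^ m *
        rexp (-√(2 * N + 1) ^ 2 / 4)) → |a - 1| ≤ (2 * τ ^ 2) ^ 2 →
      |(2 * N : ℝ) ^ ((1 : ℝ) / 4) * τ * osc m (√(2 * N + 1) + τ * s)| ≤ 2 * C * rexp (-s) ∧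
      |(2 * N : ℝ) ^ ((1 : ℝ) / 4) * τ * osc m (√(2 * N + 1) + τ * s) -
        (Ai s + (2 * p - 1) * τ ^ 2 * deriv Ai s)| ≤
        C * (2 * τ ^ 2) ^ 2 * (rexp (-s) + rexp (-s / 2)) := by
    intro m p a hp hp' hm ha ha1
    obtain ⟨b, hb1, hb2⟩ := H m p (τ ^ 2) κ s hτ0 hτ4 hκh hκ1 (by linarith) hp hp' hm hs
    refine abs_mul_le_of_norm_bounds (J := hermiteIntegral m (τ ^ 2) κ s b) (a := a) ?_ ha1 hsq
      hb1 (hb2.trans ?_)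
    · rw [hμ] at ha ⊢
      rw [Complex.ofReal_mul, osc_eq_hermiteIntegral m hτ hκ0 s b, ha]
      push_cast
      field_simp
    · have : 0 ≤ C * (τ ^ 2) ^ 2 * rexp (-s / 2) := by positivity
      linarith
  have hAN : |A - 1| ≤ (2 * τ ^ 2) ^ 2 := by
    refine hA.trans ?_
    rw [hNτ']
    have : 0 ≤ (τ ^ 2) ^ 3 := by positivity
    linarith
  have hAκ : |A * κ - 1| ≤ (2 * τ ^ 2) ^ 2 := by
    have h1 : |A * κ - 1| ≤ |(A - 1) * κ| + |κ - 1| := by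
      rw [show A * κ - 1 = (A - 1) * κ + (κ - 1) by ring]; exact abs_add_le _ _
    have h2 : |(A - 1) * κ| ≤ 1 / N := by
      rw [abs_mul, abs_of_pos hκ0]
      exact (mul_le_of_le_one_right (abs_nonneg _) hκ1).trans hA
    have h3 : |κ - 1| ≤ 1 / (4 * N) := by rwa [abs_sub_comm, abs_of_nonneg (by linarith)]
    have : 0 ≤ (τ ^ 2) ^ 3 := by positivity
    linarith
  have hE := Real.exp_pos (-s)
  obtain ⟨f1, f2⟩ := aux N (1 / 2) A (by norm_num) (by norm_num) hM hA'' hAN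
  obtain ⟨g1, g2⟩ := aux (N - 1) (3 / 2) (A * κ) (by norm_num) (by norm_num) hM' hA'.symm hAκ
  have hCE : 0 ≤ C * rexp (-s) := by positivity
  refine ⟨⟨by linarith, ?_⟩, by linarith, ?_⟩
  · refine (le_of_eq ?_).trans (f2.trans (le_of_eq (by ring)))
    congr 1; ring
  · refine (le_of_eq ?_).trans (g2.trans (le_of_eq (by ring)))
    congr 1; ring

/-- Key bounds in the orthogonal (GOE) case, with centering `μ_N = √(2N+1)`. -/
theorem orthogonal_key_bounds (sL : ℝ) :
    ∃ C > 0, ∃ N₀ : ℕ, ∀ N : ℕ, N₀ ≤ N → ∀ s : ℝ, sL ≤ s →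
      |phiTauR N s| ≤ C * Real.exp (-s) ∧
      |psiTauR N s| ≤ C * Real.exp (-s) ∧
      |phiTauR N s - Ai s| ≤ C * (N : ℝ) ^ (-(2 : ℝ) / 3) * Real.exp (-s / 2) ∧
      |psiTauR N s - Ai s - DeltaN N * deriv Ai s| ≤
        C * (N : ℝ) ^ (-(2 : ℝ) / 3) * Real.exp (-s / 2) := by
  obtain ⟨C, hC, H⟩ := exists_tauR_bounds sL
  obtain ⟨D, hD, K⟩ := exists_abs_Ai_le
  refine ⟨C * (rexp (|sL| / 2) + 1) + D * rexp (7 / 2 * |sL|), by positivity, 8,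
    fun N hN s hs => ?_⟩
  obtain ⟨⟨f1, f2⟩, g1, g2⟩ := H N hN s hs
  have hsL : -|sL| ≤ s := (neg_abs_le sL).trans hs
  have hΔ := abs_DeltaN_sub_le hN
  have hτ := tauN_pos (show N ≠ 0 by omega)
  rw [rpow_neg_two_thirds_eq]
  generalize tauN N = τ at *
  have hE := Real.exp_pos (-s)
  have hF := Real.exp_pos (-s / 2)
  have hP := Real.exp_pos (|sL| / 2)
  have hQ := Real.exp_pos (7 / 2 * |sL|)
  have hCP := mul_pos hC hP
  have hDQ := mul_pos hD hQ
  have hEF : rexp (-s) ≤ rexp (|sL| / 2) * rexp (-s / 2) := by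
    rw [← Real.exp_add]; exact Real.exp_le_exp.mpr (by linarith)
  have hAi' : |deriv Ai s| ≤ D * (rexp (7 / 2 * |sL|) * rexp (-s / 2)) := by
    refine (K s).2.trans (mul_le_mul_of_nonneg_left ?_ hD.le)
    rw [← Real.exp_add]; exact Real.exp_le_exp.mpr (by linarith)
  have hC1 : C ≤ C * (rexp (|sL| / 2) + 1) + D * rexp (7 / 2 * |sL|) := by linarith
  have hsum : C * τ ^ 4 * (rexp (-s) + rexp (-s / 2)) ≤
      C * (rexp (|sL| / 2) + 1) * τ ^ 4 * rexp (-s / 2) := by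
    calc C * τ ^ 4 * (rexp (-s) + rexp (-s / 2))
        ≤ C * τ ^ 4 * (rexp (|sL| / 2) * rexp (-s / 2) + rexp (-s / 2)) := by gcongr
      _ = _ := by ring
  have hx : 0 ≤ C * (rexp (|sL| / 2) + 1) * τ ^ 4 * rexp (-s / 2) := by positivity
  have hy : 0 ≤ D * rexp (7 / 2 * |sL|) * τ ^ 4 * rexp (-s / 2) := by positivity
  refine ⟨f1.trans (mul_le_mul_of_nonneg_right hC1 hE.le),
    g1.trans (mul_le_mul_of_nonneg_right hC1 hE.le), by linarith, ?_⟩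
  have e : psiTauR N s - Ai s - DeltaN N * deriv Ai s =
      (psiTauR N s - (Ai s + 2 * τ ^ 2 * deriv Ai s)) -
        (DeltaN N - 2 * τ ^ 2) * deriv Ai s := by ring
  have hΔA : |(DeltaN N - 2 * τ ^ 2) * deriv Ai s| ≤
      τ ^ 4 * (D * (rexp (7 / 2 * |sL|) * rexp (-s / 2))) := by
    rw [abs_mul]; gcongr
  rw [e]
  refine (abs_sub _ _).trans ?_
  linarith
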